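/- arXiv:2306.10696 — 5 statements merged into one kernel-verified Lean document; each statement's English description precedes it below -/
import Mathlib

section
/- Let p be an odd prime and let m ≥ 1 be an odd natural number. Let δ ∈ 𝔽_p be a non-square unit and E_m = diag(1, …, 1, δ) the m×m diagonal matrix with last diagonal entry δ. Then the orthogonal groups O_m(1_m) = {γ ∈ GL_m(𝔽_p) : γᵀ γ = 1_m} and O_m(E_m) = {γ ∈ GL_m(𝔽_p) : γᵀ · E_m · γ = E_m} have the same cardinality, namely #O_m(1_m) = #O_m(E_m) = 2 · p^{(m−1)²/4} · ∏_{r=1}^{(m−1)/2} (p^{2r} − 1). -/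
open Matrix
open scoped Kronecker

section
variable {F : Type*} [Field F] [Fintype F]

theorem exists_sq_add_sq_eq (hF : ringChar F ≠ 2) (t : F) : ∃ a b : F, a ^ 2 + b ^ 2 = t := by
  obtain ⟨a, b, h⟩ := FiniteField.exists_root_sum_quadratic (R := F)
    (f := Polynomial.X ^ 2) (g := Polynomial.X ^ 2 - Polynomial.C t)
    (Polynomial.degree_X_pow 2) (Polynomial.degree_X_pow_sub_C two_pos t)
    (FiniteField.odd_card_of_char_ne_two hF)
  exact ⟨a, b, by simpa [← add_sub_assoc, sub_eq_zero] using h⟩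

/-- In odd dimension, `diag(1, …, 1, δ)` is congruent to `δ` times the identity. -/
theorem exists_congruent_smul_one (hF : ringChar F ≠ 2) (δ : F) (k : ℕ) :
    ∃ P : Matrix (Fin (2 * k + 1)) (Fin (2 * k + 1)) F,
      Pᵀ * diagonal (fun i : Fin (2 * k + 1) => if (i : ℕ) = 2 * k + 1 - 1 then δ else 1) * P =
        δ • (1 : Matrix (Fin (2 * k + 1)) (Fin (2 * k + 1)) F) := by
  obtain ⟨a, b, hab⟩ := exists_sq_add_sq_eq hF δ
  let e : (Fin 2 × Fin k) ⊕ Fin 1 ≃ Fin (2 * k + 1) :=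
    (finProdFinEquiv.sumCongr (Equiv.refl _)).trans finSumFinEquiv
  let R : Matrix (Fin 2 × Fin k) (Fin 2 × Fin k) F :=
    !![a, b; -b, a] ⊗ₖ (1 : Matrix (Fin k) (Fin k) F)
  have hR : Rᵀ * R = δ • 1 := by
    have h2 : (!![a, b; -b, a] : Matrix (Fin 2) (Fin 2) F)ᵀ * !![a, b; -b, a] = δ • 1 := by
      rw [← hab]
      ext i j
      fin_cases i <;> fin_cases j <;> simp [Matrix.mul_apply] <;> ring
    rw [← kroneckerMap_transpose, ← mul_kronecker_mul, h2, smul_kronecker, transpose_one,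
      Matrix.one_mul, one_kronecker_one]
  have hE : diagonal (fun i : Fin (2 * k + 1) => if (i : ℕ) = 2 * k + 1 - 1 then δ else 1) =
      reindex e e (fromBlocks 1 0 0 (diagonal fun _ : Fin 1 => δ)) := by
    rw [← (reindex e e).symm_apply_eq, reindex_symm, reindex_apply,
      submatrix_diagonal_equiv, ← diagonal_one, fromBlocks_diagonal]
    congr 1
    ext (i | i)
    · have hi := (finProdFinEquiv i).isLt
      simp only [Function.comp, Equiv.symm_symm, Sum.elim_inl]
      rw [if_neg]
      have he : ((e (Sum.inl i) : Fin (2 * k + 1)) : ℕ) = finProdFinEquiv i := rfl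
      omega
    · simp [e]
  refine ⟨reindex e e (fromBlocks R 0 0 1), ?_⟩
  rw [hE, transpose_reindex]
  simp only [reindex_apply, submatrix_mul_equiv, fromBlocks_transpose, fromBlocks_multiply]
  have hδ : δ • (1 : Matrix (Fin (2 * k + 1)) (Fin (2 * k + 1)) F) =
      (fromBlocks (δ • 1) 0 0 (diagonal fun _ => δ)).submatrix e.symm e.symm := by
    simp only [smul_one_eq_diagonal, fromBlocks_diagonal, submatrix_diagonal_equiv]
    congr 1
    ext i
    obtain ⟨j | j, rfl⟩ := e.surjective i <;> simp
  rw [hδ]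
  simp [hR]

variable [DecidableEq F]

/-- The number of vectors of length `n` over `F` whose squares sum to `c`. -/
def numSumSq (F : Type*) [Field F] [Fintype F] [DecidableEq F] (n : ℕ) (c : F) : ℕ :=
  Fintype.card {x : Fin n → F // ∑ i, x i ^ 2 = c}

theorem numSumSq_succ (n : ℕ) (c : F) :
    numSumSq F (n + 1) c = ∑ u : F, numSumSq F n (c - u ^ 2) := by
  unfold numSumSq
  rw [← Fintype.card_sigma]
  refine Fintype.card_congr
    { toFun := fun x => ⟨x.1 0, fun i => x.1 i.succ, ?_⟩
      invFun := fun y => ⟨Fin.cons y.1 y.2.1, ?_⟩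
      left_inv := ?_
      right_inv := ?_ }
  · have hx := x.2
    rw [Fin.sum_univ_succ] at hx
    exact eq_sub_of_add_eq' hx
  · rw [Fin.sum_univ_succ]; simp [y.2.2]
  · rintro ⟨x, hx⟩
    ext i
    refine Fin.cases ?_ (fun i => ?_) i <;> simp
  · rintro ⟨u, y, hy⟩
    rfl

theorem sum_numSumSq (n : ℕ) : ∑ c : F, numSumSq F n c = Fintype.card F ^ n := by
  unfold numSumSq
  rw [← Fintype.card_sigma,
    Fintype.card_congr (Equiv.sigmaFiberEquiv fun x : Fin n → F => ∑ i, x i ^ 2)]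
  simp

theorem numSumSq_one_eq (hF : ringChar F ≠ 2) (c : F) :
    (numSumSq F 1 c : ℤ) = quadraticChar F c + 1 := by
  rw [← quadraticChar_card_sqrts hF, numSumSq, Set.toFinset_card]
  norm_cast
  exact Fintype.card_congr
    ((Equiv.funUnique (Fin 1) F).subtypeEquiv fun x => by simp)

theorem numSumSq_two_zero (hF : ringChar F ≠ 2) :
    (numSumSq F 2 0 : ℤ) =
      Fintype.card F + (Fintype.card F - 1) * quadraticChar F (-1) := by
  rw [numSumSq_succ]
  push_cast
  have h (u : F) : (numSumSq F 1 (0 - u ^ 2) : ℤ) =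
      1 + (quadraticChar F (-1) - if u = 0 then quadraticChar F (-1) else 0) := by
    rw [numSumSq_one_eq hF, zero_sub, neg_eq_neg_one_mul, map_mul]
    split_ifs with hu
    · simp [hu]
    · rw [quadraticChar_sq_one' hu]; ring
  simp_rw [h, Finset.sum_add_distrib, Finset.sum_sub_distrib]
  simp
  ring

/-- Multiplication by a unit `a + b√-1` matches representations of `1` and of `a² + b²`. -/
theorem numSumSq_two_eq_one (hF : ringChar F ≠ 2) {t : F} (ht : t ≠ 0) :
    numSumSq F 2 t = numSumSq F 2 1 := by
  obtain ⟨a, b, hab⟩ := exists_sq_add_sq_eq hF t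
  refine Fintype.card_congr
    { toFun := fun x => ⟨![(a * x.1 0 + b * x.1 1) / t, (a * x.1 1 - b * x.1 0) / t], ?_⟩
      invFun := fun x => ⟨![a * x.1 0 - b * x.1 1, a * x.1 1 + b * x.1 0], ?_⟩
      left_inv := ?_
      right_inv := ?_ }
  · obtain ⟨x, hx⟩ := x
    simp only [Fin.sum_univ_two, cons_val_zero, cons_val_one] at hx ⊢
    field_simp
    linear_combination (x 0 ^ 2 + x 1 ^ 2) * hab + t * hx
  · obtain ⟨x, hx⟩ := x
    simp only [Fin.sum_univ_two, cons_val_zero, cons_val_one] at hx ⊢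
    linear_combination (x 0 ^ 2 + x 1 ^ 2) * hab + t * hx
  · rintro ⟨x, hx⟩
    ext i
    fin_cases i <;> simp <;> field_simp
    · linear_combination x 0 * hab
    · linear_combination x 1 * hab
  · rintro ⟨x, hx⟩
    ext i
    fin_cases i <;> simp <;> field_simp
    · linear_combination x 0 * hab
    · linear_combination x 1 * hab

theorem numSumSq_two (hF : ringChar F ≠ 2) (t : F) :
    (numSumSq F 2 t : ℤ) = Fintype.card F - quadraticChar F (-1) +
      if t = 0 then Fintype.card F * quadraticChar F (-1) else 0 := by
  split_ifs with ht
  · rw [ht, numSumSq_two_zero hF]; ring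
  have h : (∑ c : F, (numSumSq F 2 c : ℤ)) = (Fintype.card F : ℤ) ^ 2 := by
    exact_mod_cast sum_numSumSq (F := F) 2
  have h1 (c : F) : (numSumSq F 2 c : ℤ) =
      numSumSq F 2 1 + if c = 0 then (numSumSq F 2 0 : ℤ) - numSumSq F 2 1 else 0 := by
    split_ifs with hc
    · simp [hc]
    · rw [numSumSq_two_eq_one hF hc, add_zero]
  rw [Finset.sum_congr rfl fun c _ => h1 c, Finset.sum_add_distrib] at h
  simp only [Finset.sum_const, Finset.card_univ, nsmul_eq_mul, Finset.sum_ite_eq',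
    Finset.mem_univ, if_true, numSumSq_two_zero hF] at h
  rw [numSumSq_two_eq_one hF ht]
  have hq : (Fintype.card F : ℤ) - 1 ≠ 0 := by
    have : 1 < Fintype.card F := Fintype.one_lt_card
    omega
  apply mul_left_cancel₀ hq
  linear_combination h

theorem numSumSq_add_two (hF : ringChar F ≠ 2) (n : ℕ) (c : F) :
    (numSumSq F (n + 2) c : ℤ) =
      (Fintype.card F - quadraticChar F (-1)) * Fintype.card F ^ n +
        Fintype.card F * quadraticChar F (-1) * numSumSq F n c := by
  have key : numSumSq F (n + 2) c = ∑ t : F, numSumSq F 2 t * numSumSq F n (c - t) := by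
    have h0 (t : F) : numSumSq F 0 t = if t = 0 then 1 else 0 := by
      split_ifs with h <;> simp [numSumSq, h, Fintype.card_subtype, eq_comm]
    have h2 (t : F) :
        numSumSq F 2 t = ∑ u : F, ∑ v : F, if t - u ^ 2 - v ^ 2 = 0 then 1 else 0 := by
      simp only [numSumSq_succ, h0]
    simp only [h2, Finset.sum_mul, ite_mul, one_mul, zero_mul]
    rw [Finset.sum_comm, numSumSq_succ]
    refine Finset.sum_congr rfl fun u _ => ?_
    rw [Finset.sum_comm, numSumSq_succ]
    refine Finset.sum_congr rfl fun v _ => ?_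
    rw [Finset.sum_eq_single (u ^ 2 + v ^ 2)]
    · simp [sub_sub]
    · intro t _ ht
      rw [if_neg]
      intro h
      exact ht (by linear_combination h)
    · simp
  rw [key]
  push_cast
  have hs : (∑ t : F, (numSumSq F n (c - t) : ℤ)) = (Fintype.card F : ℤ) ^ n := by
    rw [← Nat.cast_pow, ← sum_numSumSq n, ← (Equiv.subLeft c).sum_comp]
    simp
  simp only [numSumSq_two hF, add_mul, Finset.sum_add_distrib, ← Finset.mul_sum, hs, ite_mul,
    zero_mul, Finset.sum_ite_eq', Finset.mem_univ, if_true, sub_zero]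

theorem numSumSq_even_one (hF : ringChar F ≠ 2) (k : ℕ) :
    (numSumSq F (2 * (k + 1)) 1 : ℤ) =
      Fintype.card F ^ k * (Fintype.card F ^ (k + 1) - quadraticChar F (-1) ^ (k + 1)) := by
  induction k with
  | zero => simp [numSumSq_two hF]
  | succ k ih =>
    rw [show 2 * (k + 1 + 1) = 2 * (k + 1) + 2 by ring, numSumSq_add_two hF, ih]
    ring

theorem numSumSq_odd_one (hF : ringChar F ≠ 2) (k : ℕ) :
    (numSumSq F (2 * k + 1) 1 : ℤ) =
      Fintype.card F ^ k * (Fintype.card F ^ k + quadraticChar F (-1) ^ k) := by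
  induction k with
  | zero => simp [numSumSq_one_eq hF]
  | succ k ih =>
    rw [show 2 * (k + 1) + 1 = 2 * k + 1 + 2 by ring, numSumSq_add_two hF, ih]
    ring

theorem numSumSq_even_mul_odd (hF : ringChar F ≠ 2) (k : ℕ) :
    numSumSq F (2 * (k + 1)) 1 * numSumSq F (2 * (k + 1) + 1) 1 =
      Fintype.card F ^ (2 * k + 1) * (Fintype.card F ^ (2 * (k + 1)) - 1) := by
  have h1 : 1 ≤ Fintype.card F ^ (2 * (k + 1)) := Nat.one_le_pow _ _ Fintype.card_pos
  have hε : quadraticChar F (-1) ^ 2 = 1 := quadraticChar_sq_one (neg_ne_zero.2 one_ne_zero)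
  have hε' : (quadraticChar F (-1) ^ (k + 1)) ^ 2 = 1 := by rw [pow_right_comm, hε, one_pow]
  zify [h1]
  rw [numSumSq_even_one hF, numSumSq_odd_one hF]
  linear_combination (-(Fintype.card F : ℤ) ^ (2 * k + 1)) * hε'
end

section
variable {F : Type*} [Field F] {ι : Type*} [Fintype ι] [DecidableEq ι]

/-- The Householder matrix of a non-isotropic vector is orthogonal. -/
theorem householder_transpose_mul_self {w : ι → F} (hw : w ⬝ᵥ w ≠ 0) :
    (1 - (2 / (w ⬝ᵥ w)) • vecMulVec w w)ᵀ * (1 - (2 / (w ⬝ᵥ w)) • vecMulVec w w) = 1 := by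
  rw [transpose_sub, transpose_smul, transpose_vecMulVec, transpose_one, sub_mul, mul_sub, mul_sub,
    smul_mul_smul_comm, vecMulVec_mul_vecMulVec, vecMulVec_smul, smul_smul]
  have : 2 / (w ⬝ᵥ w) * (2 / (w ⬝ᵥ w)) * (w ⬝ᵥ w) = 2 / (w ⬝ᵥ w) + 2 / (w ⬝ᵥ w) := by
    field_simp; norm_num
  rw [this, add_smul]
  simp

/-- The orthogonal matrices act transitively on vectors of length one. -/
theorem exists_orthogonal_mulVec_eq (h2 : (2 : F) ≠ 0) {e x : ι → F} (he : e ⬝ᵥ e = 1)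
    (hx : x ⬝ᵥ x = 1) : ∃ H : Matrix ι ι F, Hᵀ * H = 1 ∧ H *ᵥ e = x := by
  have hmul (w : ι → F) : (1 - (2 / (w ⬝ᵥ w)) • vecMulVec w w) *ᵥ e =
      e - (2 / (w ⬝ᵥ w) * (w ⬝ᵥ e)) • w := by
    rw [sub_mulVec, one_mulVec, smul_mulVec, vecMulVec_mulVec, op_smul_eq_smul, smul_smul]
  by_cases hw : (x - e) ⬝ᵥ (x - e) = 0
  · have hs : (x + e) ⬝ᵥ (x + e) = 2 * ((x + e) ⬝ᵥ e) := by
      simp only [add_dotProduct, dotProduct_add, dotProduct_comm e x, he, hx]; ring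
    have hw' : (x + e) ⬝ᵥ (x + e) ≠ 0 := by
      intro h
      have h4 : (2 : F) * 2 = 0 := by
        simp only [add_dotProduct, dotProduct_add, sub_dotProduct, dotProduct_sub, he, hx] at h hw
        linear_combination h + hw
      exact h2 (mul_self_eq_zero.1 h4)
    refine ⟨-(1 - (2 / ((x + e) ⬝ᵥ (x + e))) • vecMulVec (x + e) (x + e)), ?_, ?_⟩
    · rw [transpose_neg, neg_mul_neg, householder_transpose_mul_self hw']
    · have h1 : 2 / ((x + e) ⬝ᵥ (x + e)) * ((x + e) ⬝ᵥ e) = 1 := by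
        rw [div_mul_eq_mul_div, ← hs, div_self hw']
      rw [neg_mulVec, hmul, h1, one_smul]
      abel
  · have hs : (x - e) ⬝ᵥ (x - e) = -(2 * ((x - e) ⬝ᵥ e)) := by
      simp only [sub_dotProduct, dotProduct_sub, dotProduct_comm e x, he, hx]; ring
    refine ⟨1 - (2 / ((x - e) ⬝ᵥ (x - e))) • vecMulVec (x - e) (x - e),
      householder_transpose_mul_self hw, ?_⟩
    have h1 : 2 / ((x - e) ⬝ᵥ (x - e)) * ((x - e) ⬝ᵥ e) = -1 := by
      rw [div_mul_eq_mul_div, div_eq_iff hw, hs]; ring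
    rw [hmul, h1]
    simp

theorem card_orthogonal_congr {κ : Type*} [Fintype κ] [DecidableEq κ] (e : ι ≃ κ) :
    Nat.card {M : Matrix ι ι F // Mᵀ * M = 1} = Nat.card {M : Matrix κ κ F // Mᵀ * M = 1} :=
  Nat.card_congr <| (reindex e e).subtypeEquiv fun M => by
    rw [transpose_reindex, reindex_apply, reindex_apply, submatrix_mul_equiv,
      ← submatrix_one_equiv e.symm]
    exact (reindex e e).injective.eq_iff.symm

theorem eq_fromBlocks_of_orthogonal {M : Matrix (Unit ⊕ ι) (Unit ⊕ ι) F} (h : Mᵀ * M = 1)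
    (hM : M *ᵥ Pi.single (Sum.inl ()) 1 = Pi.single (Sum.inl ()) 1) :
    M = fromBlocks 1 0 0 M.toBlocks₂₂ := by
  rw [mulVec_single_one] at hM
  have h11 : M.toBlocks₁₁ = 1 := by
    ext i j
    simpa [toBlocks₁₁] using congrFun hM (Sum.inl ())
  have h21 : M.toBlocks₂₁ = 0 := by
    ext i j
    simpa [toBlocks₂₁] using congrFun hM (Sum.inr i)
  rw [← fromBlocks_toBlocks M, h11, h21, fromBlocks_transpose, fromBlocks_multiply,
    ← fromBlocks_one, fromBlocks_inj] at h
  have h12 : M.toBlocks₁₂ = 0 := by simpa using h.2.1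
  conv_lhs => rw [← fromBlocks_toBlocks M, h11, h12, h21]

theorem fromBlocks_one_transpose_mul_self_eq_one_iff {N : Matrix ι ι F} :
    (fromBlocks (1 : Matrix Unit Unit F) 0 0 N)ᵀ * fromBlocks 1 0 0 N = 1 ↔ Nᵀ * N = 1 := by
  rw [fromBlocks_transpose, fromBlocks_multiply, ← fromBlocks_one, fromBlocks_inj]
  simp

/-- The orthogonal matrices fixing the first basis vector form an orthogonal group of one
dimension less. -/
def orthogonalStabilizerEquiv :
    {M : Matrix (Unit ⊕ ι) (Unit ⊕ ι) F // Mᵀ * M = 1 ∧ M *ᵥ Pi.single (Sum.inl ()) 1 =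
      Pi.single (Sum.inl ()) 1} ≃ {M : Matrix ι ι F // Mᵀ * M = 1} where
  toFun M := ⟨M.1.toBlocks₂₂, fromBlocks_one_transpose_mul_self_eq_one_iff.1 <| by
    rw [← eq_fromBlocks_of_orthogonal M.2.1 M.2.2, M.2.1]⟩
  invFun M := ⟨fromBlocks 1 0 0 M.1, fromBlocks_one_transpose_mul_self_eq_one_iff.2 M.2, by
    rw [mulVec_single_one]
    ext (i | i) <;> simp [col]⟩
  left_inv M := Subtype.ext (eq_fromBlocks_of_orthogonal M.2.1 M.2.2).symm
  right_inv M := by simp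

theorem card_orthogonal_unit_sum [Finite F] (h2 : (2 : F) ≠ 0) :
    Nat.card {M : Matrix (Unit ⊕ ι) (Unit ⊕ ι) F // Mᵀ * M = 1} =
      Nat.card {x : Unit ⊕ ι → F // x ⬝ᵥ x = 1} * Nat.card {M : Matrix ι ι F // Mᵀ * M = 1} := by
  set e : Unit ⊕ ι → F := Pi.single (Sum.inl ()) 1 with he_def
  have he : e ⬝ᵥ e = 1 := by simp [he_def]
  let f (M : {M : Matrix (Unit ⊕ ι) (Unit ⊕ ι) F // Mᵀ * M = 1}) :
      {x : Unit ⊕ ι → F // x ⬝ᵥ x = 1} := ⟨M.1 *ᵥ e, by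
    rw [dotProduct_mulVec, vecMul_mulVec, M.2, vecMul_one, he]⟩
  rw [← Nat.card_congr (orthogonalStabilizerEquiv (F := F) (ι := ι)), ← Nat.card_prod]
  refine Nat.card_congr <| (Equiv.sigmaFiberEquiv f).symm.trans <|
    (Equiv.sigmaCongrRight fun x => ?_).trans (Equiv.sigmaEquivProd _ _)
  let H := (exists_orthogonal_mulVec_eq h2 he x.2).choose
  have hH : Hᵀ * H = 1 := (exists_orthogonal_mulVec_eq h2 he x.2).choose_spec.1
  have hHx : H *ᵥ e = x.1 := (exists_orthogonal_mulVec_eq h2 he x.2).choose_spec.2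
  have hH' : H * Hᵀ = 1 := mul_eq_one_comm.1 hH
  exact
    { toFun := fun M => ⟨Hᵀ * M.1.1, by
        rw [transpose_mul, transpose_transpose, Matrix.mul_assoc, ← Matrix.mul_assoc H, hH',
          Matrix.one_mul, M.1.2], by
        have : M.1.1 *ᵥ e = x.1 := congrArg Subtype.val M.2
        rw [← mulVec_mulVec, this, ← hHx, mulVec_mulVec, hH, one_mulVec]⟩
      invFun := fun M => ⟨⟨H * M.1, by
        rw [transpose_mul, Matrix.mul_assoc, ← Matrix.mul_assoc Hᵀ, hH, Matrix.one_mul, M.2.1]⟩,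
        Subtype.ext (by
          change (H * M.1) *ᵥ e = x.1
          rw [← mulVec_mulVec, M.2.2, hHx])⟩
      left_inv := fun M => by
        ext1; ext1
        simp only [← Matrix.mul_assoc, hH', Matrix.one_mul]
      right_inv := fun M => by
        ext1
        simp only [← Matrix.mul_assoc, hH, Matrix.one_mul] }

/-- A matrix congruent to a multiple of the identity has as many isometries as the identity. -/
theorem card_isometry_eq_of_congruent_smul {δ : F} (hδ : δ ≠ 0) {E P : Matrix ι ι F}
    (hP : Pᵀ * E * P = δ • (1 : Matrix ι ι F)) :
    Nat.card {γ : GL ι F // (γ : Matrix ι ι F)ᵀ * (γ : Matrix ι ι F) = 1} =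
      Nat.card {γ : GL ι F // (γ : Matrix ι ι F)ᵀ * E * (γ : Matrix ι ι F) = E} := by
  have hdet : IsUnit P.det := by
    have := congrArg det hP
    rw [det_mul, det_smul, det_one, mul_one] at this
    refine isUnit_iff_ne_zero.2 fun h => pow_ne_zero (Fintype.card ι) hδ ?_
    rw [← this, h, mul_zero]
  obtain ⟨Q, rfl⟩ : ∃ Q : GL ι F, (Q : Matrix ι ι F) = P :=
    ⟨P.nonsingInvUnit hdet, rfl⟩
  have cancel (A B : Matrix ι ι F) :
      (Q : Matrix ι ι F)ᵀ * A * (Q : Matrix ι ι F) = (Q : Matrix ι ι F)ᵀ * B * Q ↔ A = B := by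
    have hT : IsUnit (Q : Matrix ι ι F)ᵀ := (Matrix.isUnit_transpose _).2 Q.isUnit
    rw [Q.isUnit.mul_left_inj, hT.mul_right_inj]
  refine Nat.card_congr <| (MulAut.conj Q).toEquiv.subtypeEquiv fun γ => ?_
  obtain ⟨N, hN⟩ : ∃ N : GL ι F, N = MulAut.conj Q γ := ⟨_, rfl⟩
  have h1 : (N : Matrix ι ι F) * (Q : Matrix ι ι F) = Q * γ := by
    rw [← Units.val_mul, ← Units.val_mul, hN]
    simp [MulAut.conj_apply]
  change _ ↔ ((MulAut.conj Q γ : GL ι F) : Matrix ι ι F)ᵀ * E *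
    ((MulAut.conj Q γ : GL ι F) : Matrix ι ι F) = E
  have h3 : (Q : Matrix ι ι F)ᵀ * ((N : Matrix ι ι F)ᵀ * E * (N : Matrix ι ι F)) * Q =
      δ • ((γ : Matrix ι ι F)ᵀ * γ) :=
    calc _ = ((N : Matrix ι ι F) * (Q : Matrix ι ι F))ᵀ * E *
            ((N : Matrix ι ι F) * (Q : Matrix ι ι F)) := by
          simp only [transpose_mul, Matrix.mul_assoc]
      _ = (γ : Matrix ι ι F)ᵀ * ((Q : Matrix ι ι F)ᵀ * E * (Q : Matrix ι ι F)) *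
          (γ : Matrix ι ι F) := by
          rw [h1]; simp only [transpose_mul, Matrix.mul_assoc]
      _ = _ := by rw [hP]; simp
  rw [← hN, ← cancel (_ * E * _), h3, hP, (smul_right_injective _ hδ).eq_iff]

theorem card_GL_orthogonal :
    Nat.card {γ : GL ι F // (γ : Matrix ι ι F)ᵀ * (γ : Matrix ι ι F) = 1} =
      Nat.card {M : Matrix ι ι F // Mᵀ * M = 1} :=
  Nat.card_congr
    { toFun := fun γ => ⟨γ.1, γ.2⟩
      invFun := fun M => ⟨⟨M.1, M.1ᵀ, mul_eq_one_comm.1 M.2, M.2⟩, M.2⟩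
      left_inv := fun γ => by ext; rfl
      right_inv := fun M => rfl }
end

section
variable {F : Type*} [Field F] [Fintype F] [DecidableEq F]

theorem card_orthogonal_fin_succ (hF : ringChar F ≠ 2) (n : ℕ) :
    Nat.card {M : Matrix (Fin (n + 1)) (Fin (n + 1)) F // Mᵀ * M = 1} =
      numSumSq F (n + 1) 1 * Nat.card {M : Matrix (Fin n) (Fin n) F // Mᵀ * M = 1} := by
  let e : Unit ⊕ Fin n ≃ Fin (n + 1) := Fintype.equivOfCardEq (by simp [add_comm])
  rw [← card_orthogonal_congr e, card_orthogonal_unit_sum (Ring.two_ne_zero hF), numSumSq,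
    ← Nat.card_eq_fintype_card]
  congr 1
  refine Nat.card_congr ((e.arrowCongr (Equiv.refl F)).subtypeEquiv fun x => ?_)
  have h : ∑ i, (e.arrowCongr (Equiv.refl F)) x i ^ 2 = x ⬝ᵥ x := by
    simp only [dotProduct, ← sq]
    exact e.symm.sum_comp fun i => x i ^ 2
  rw [h]

theorem card_orthogonal_odd (hF : ringChar F ≠ 2) (k : ℕ) :
    Nat.card {M : Matrix (Fin (2 * k + 1)) (Fin (2 * k + 1)) F // Mᵀ * M = 1} =
      2 * Fintype.card F ^ k ^ 2 *
        ∏ r ∈ Finset.Icc 1 k, (Fintype.card F ^ (2 * r) - 1) := by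
  induction k with
  | zero =>
    have h : numSumSq F 1 1 = 2 := by
      have := numSumSq_odd_one (F := F) hF 0
      norm_num at this
      exact_mod_cast this
    have h0 : Nat.card {M : Matrix (Fin 0) (Fin 0) F // Mᵀ * M = 1} = 1 :=
      Nat.card_eq_one_iff_unique.2 ⟨inferInstance, ⟨⟨1, Subsingleton.elim _ _⟩⟩⟩
    rw [card_orthogonal_fin_succ hF, h, h0]
    simp
  | succ k ih =>
    rw [Finset.prod_Icc_succ_top (by omega), card_orthogonal_fin_succ hF,
      show 2 * (k + 1) = 2 * k + 1 + 1 by ring, card_orthogonal_fin_succ hF, ih, ← mul_assoc,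
      mul_comm (numSumSq F _ 1)]
    have h := numSumSq_even_mul_odd hF k
    rw [show 2 * (k + 1) = 2 * k + 1 + 1 by ring] at h
    rw [h]
    ring
end

theorem stmt_2 (p : ℕ) (hp : p.Prime) (hp2 : p ≠ 2) (m : ℕ) (hm : 1 ≤ m) (hodd : Odd m)
    (δ : ZMod p) (hδunit : IsUnit δ) (hδ : ¬∃ x : ZMod p, x ^ 2 = δ) :
    Nat.card {γ : GL (Fin m) (ZMod p) //
        (γ : Matrix (Fin m) (Fin m) (ZMod p))ᵀ * (γ : Matrix (Fin m) (Fin m) (ZMod p)) = 1} =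
      Nat.card {γ : GL (Fin m) (ZMod p) //
        (γ : Matrix (Fin m) (Fin m) (ZMod p))ᵀ *
          Matrix.diagonal (fun i : Fin m => if (i : ℕ) = m - 1 then δ else 1) *
          (γ : Matrix (Fin m) (Fin m) (ZMod p)) =
          Matrix.diagonal (fun i : Fin m => if (i : ℕ) = m - 1 then δ else 1)} ∧
    Nat.card {γ : GL (Fin m) (ZMod p) //
        (γ : Matrix (Fin m) (Fin m) (ZMod p))ᵀ * (γ : Matrix (Fin m) (Fin m) (ZMod p)) = 1} =
      2 * p ^ ((m - 1) ^ 2 / 4) * ∏ r ∈ Finset.Icc 1 ((m - 1) / 2), (p ^ (2 * r) - 1) := by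
  have : Fact p.Prime := ⟨hp⟩
  have hF : ringChar (ZMod p) ≠ 2 := by rwa [ZMod.ringChar_zmod_n]
  obtain ⟨k, rfl⟩ := hodd
  obtain ⟨P, hP⟩ := exists_congruent_smul_one hF δ k
  have : NeZero p := ⟨hp.ne_zero⟩
  refine ⟨card_isometry_eq_of_congruent_smul hδunit.ne_zero hP, ?_⟩
  have h1 : (2 * k + 1 - 1) ^ 2 / 4 = k ^ 2 := by
    rw [Nat.add_sub_cancel, mul_pow]; omega
  have h2 : (2 * k + 1 - 1) / 2 = k := by omega
  rw [card_GL_orthogonal, card_orthogonal_odd hF, h1, h2, ZMod.card]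
end

section
/- Let p be an odd prime and let m ≥ 2 be an even natural number. Let δ ∈ 𝔽_p be a non-square unit and E_m = diag(1, …, 1, δ) the m×m diagonal matrix with last diagonal entry δ. Set ε = ((−1)^{(p−1)/2})^{m/2} ∈ {+1, −1}. Then the cardinality of O_m(E_m) = {γ ∈ GL_m(𝔽_p) : γᵀ · E_m · γ = E_m}, viewed as an integer, equals 2 · p^{(m²−2m)/4} · (p^{m/2} + ε) · ∏_{r=1}^{m/2−1} (p^{2r} − 1). -/
open Matrix

/-- The matrices preserving the diagonal bilinear form with coefficients `d`. -/
def diagonalIsometries {ι F : Type*} [Fintype ι] [DecidableEq ι] [Field F] (d : ι → F) :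
    Set (Matrix ι ι F) :=
  {M | Mᵀ * diagonal d * M = diagonal d}

section Isometries

variable {ι κ F : Type*} [Fintype ι] [DecidableEq ι] [Fintype κ] [DecidableEq κ] [Field F]

theorem mem_diagonalIsometries {d : ι → F} {M : Matrix ι ι F} :
    M ∈ diagonalIsometries d ↔ Mᵀ * diagonal d * M = diagonal d := Iff.rfl

theorem mul_mem_diagonalIsometries {d : ι → F} {M N : Matrix ι ι F}
    (hM : M ∈ diagonalIsometries d) (hN : N ∈ diagonalIsometries d) :
    M * N ∈ diagonalIsometries d := by
  rw [mem_diagonalIsometries] at *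
  calc (M * N)ᵀ * diagonal d * (M * N) = Nᵀ * (Mᵀ * diagonal d * M) * N := by
        simp only [transpose_mul, Matrix.mul_assoc]
    _ = diagonal d := by rw [hM, hN]

theorem isUnit_det_of_mem_diagonalIsometries {d : ι → F} (hd : ∀ i, d i ≠ 0) {M : Matrix ι ι F}
    (hM : M ∈ diagonalIsometries d) : IsUnit M.det := by
  have h := congrArg det (mem_diagonalIsometries.1 hM)
  rw [isUnit_iff_ne_zero]
  intro h0
  simp only [det_mul, h0, mul_zero, det_diagonal] at h
  exact Finset.prod_ne_zero_iff.2 (fun i _ => hd i) h.symm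

theorem inv_mem_diagonalIsometries {d : ι → F} {M : Matrix ι ι F} (hu : IsUnit M.det)
    (hM : M ∈ diagonalIsometries d) : M⁻¹ ∈ diagonalIsometries d := by
  rw [mem_diagonalIsometries] at *
  have h : M * M⁻¹ = 1 := mul_nonsing_inv M hu
  have h' : (M⁻¹)ᵀ * Mᵀ = 1 := by rw [← transpose_mul, h, transpose_one]
  calc (M⁻¹)ᵀ * diagonal d * M⁻¹ = (M⁻¹)ᵀ * (Mᵀ * diagonal d * M) * M⁻¹ := by rw [hM]
    _ = ((M⁻¹)ᵀ * Mᵀ) * diagonal d * (M * M⁻¹) := by simp only [Matrix.mul_assoc]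
    _ = diagonal d := by rw [h, h', Matrix.one_mul, Matrix.mul_one]

theorem card_diagonalIsometries_comp (e : ι ≃ κ) (d : κ → F) :
    Nat.card (diagonalIsometries (d ∘ e)) = Nat.card (diagonalIsometries d) := by
  refine Nat.card_congr ((reindex e e).subtypeEquiv fun M => ?_)
  have hD : diagonal d = (diagonal (d ∘ e)).submatrix e.symm e.symm := by
    rw [submatrix_diagonal_equiv, Function.comp_assoc, e.self_comp_symm, Function.comp_id]
  change _ ↔ (M.submatrix e.symm e.symm)ᵀ * diagonal d * M.submatrix e.symm e.symm = diagonal d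
  rw [hD, transpose_submatrix, submatrix_mul_equiv, submatrix_mul_equiv]
  exact (reindex e e).injective.eq_iff.symm

theorem card_GL_preserving_diagonal {d : ι → F} (hd : ∀ i, d i ≠ 0) :
    Nat.card {γ : GL ι F // (γ : Matrix ι ι F)ᵀ * diagonal d * (γ : Matrix ι ι F) = diagonal d} =
      Nat.card (diagonalIsometries d) := by
  refine Nat.card_eq_of_bijective (fun γ => ⟨γ.1.1, γ.2⟩) ⟨fun a b h => ?_, fun M => ?_⟩
  · exact Subtype.ext (Units.ext (congrArg Subtype.val h))
  · exact ⟨⟨GeneralLinearGroup.mk'' M.1 (isUnit_det_of_mem_diagonalIsometries hd M.2), M.2⟩, rfl⟩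

/-- The reflection in the hyperplane orthogonal to `u` is an isometry. -/
theorem reflection_mem_diagonalIsometries (d u : ι → F) (hu : u ⬝ᵥ diagonal d *ᵥ u ≠ 0) :
    1 - (2 / (u ⬝ᵥ diagonal d *ᵥ u)) • vecMulVec u (diagonal d *ᵥ u) ∈ diagonalIsometries d := by
  set w := diagonal d *ᵥ u
  set q := u ⬝ᵥ w
  have h1 : vecMulVec w u * diagonal d = vecMulVec w w := by
    rw [vecMulVec_mul, ← mulVec_transpose, diagonal_transpose]
  have h2 : diagonal d * vecMulVec u w = vecMulVec w w := by
    rw [mul_vecMulVec]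
  have h3 : vecMulVec w w * vecMulVec u w = q • vecMulVec w w := by
    rw [vecMulVec_mul_vecMulVec, dotProduct_comm w u, vecMulVec_smul]
  rw [mem_diagonalIsometries, transpose_sub, transpose_smul, transpose_vecMulVec, transpose_one,
    Matrix.sub_mul, Matrix.one_mul, Matrix.smul_mul, h1, Matrix.mul_sub, Matrix.mul_one,
    Matrix.sub_mul, Matrix.smul_mul, Matrix.mul_smul, Matrix.mul_smul, h2, h3]
  have h4 : (2 / q) * (2 / q * q) = 2 / q + 2 / q := by field_simp; norm_num
  have h5 : (2 / q) • (2 / q) • q • vecMulVec w w =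
      (2 / q) • vecMulVec w w + (2 / q) • vecMulVec w w := by
    rw [smul_smul, smul_smul, mul_assoc, h4, add_smul]
  rw [h5]
  abel

theorem exists_diagonalIsometry_mulVec_eq (h2 : (2 : F) ≠ 0) (d : ι → F) {v w : ι → F}
    (hv : v ⬝ᵥ diagonal d *ᵥ v = 1) (hw : w ⬝ᵥ diagonal d *ᵥ w = 1) :
    ∃ M ∈ diagonalIsometries d, M *ᵥ v = w := by
  have hsymm : v ⬝ᵥ diagonal d *ᵥ w = w ⬝ᵥ diagonal d *ᵥ v := by
    rw [dotProduct_mulVec, ← mulVec_transpose, diagonal_transpose, dotProduct_comm]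
  have refl_sub : ∀ w : ι → F, w ⬝ᵥ diagonal d *ᵥ w = 1 →
      v ⬝ᵥ diagonal d *ᵥ w = w ⬝ᵥ diagonal d *ᵥ v →
      (v - w) ⬝ᵥ diagonal d *ᵥ (v - w) ≠ 0 → ∃ M ∈ diagonalIsometries d, M *ᵥ v = w := by
    intro w hw hsymm hne
    refine ⟨_, reflection_mem_diagonalIsometries d (v - w) hne, ?_⟩
    have hq : (v - w) ⬝ᵥ diagonal d *ᵥ (v - w) = 2 * ((diagonal d *ᵥ (v - w)) ⬝ᵥ v) := by
      rw [dotProduct_comm _ v]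
      simp only [mulVec_sub, dotProduct_sub, sub_dotProduct, hv, hw, hsymm]
      ring
    rw [hq] at hne ⊢
    have hne' := right_ne_zero_of_mul hne
    rw [sub_mulVec, one_mulVec, smul_mulVec, vecMulVec_mulVec, op_smul_eq_smul, smul_smul]
    rw [show 2 / (2 * ((diagonal d *ᵥ (v - w)) ⬝ᵥ v)) * ((diagonal d *ᵥ (v - w)) ⬝ᵥ v) = 1 by
      field_simp]
    simp
  by_cases h : (v - w) ⬝ᵥ diagonal d *ᵥ (v - w) = 0
  · obtain ⟨M, hM, hMv⟩ := refl_sub (-w) (by simpa [mulVec_neg] using hw)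
      (by simpa [mulVec_neg] using hsymm) (by
        intro h'
        have h4 : (2 : F) * 2 = 0 := by
          simp only [mulVec_sub, mulVec_neg, dotProduct_sub, sub_dotProduct, dotProduct_neg,
            neg_dotProduct, hv, hw, hsymm] at h h'
          linear_combination h + h'
        exact h2 (mul_self_eq_zero.1 h4))
    refine ⟨-M, ?_, by rw [neg_mulVec, hMv, neg_neg]⟩
    simpa [mem_diagonalIsometries] using hM
  · exact refl_sub w hw hsymm h

theorem fromBlocks_mem_diagonalIsometries {d : ι → F} {N : Matrix ι ι F} :
    fromBlocks N 0 0 (1 : Matrix Unit Unit F) ∈ diagonalIsometries (Sum.elim d fun _ => 1) ↔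
      N ∈ diagonalIsometries d := by
  rw [mem_diagonalIsometries, mem_diagonalIsometries, ← fromBlocks_diagonal, fromBlocks_transpose,
    fromBlocks_multiply, fromBlocks_multiply, fromBlocks_inj]
  simp

theorem exists_fromBlocks_of_mulVec_single {d : ι → F} {M : Matrix (ι ⊕ Unit) (ι ⊕ Unit) F}
    (hM : M ∈ diagonalIsometries (Sum.elim d fun _ => 1))
    (he : M *ᵥ Pi.single (Sum.inr ()) 1 = Pi.single (Sum.inr ()) 1) :
    ∃ N ∈ diagonalIsometries d, M = fromBlocks N 0 0 1 := by
  have hcol : ∀ i, M i (Sum.inr ()) = (Pi.single (Sum.inr ()) 1 : ι ⊕ Unit → F) i := fun i => by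
    rw [← he]; simp
  have hrow : ∀ j, M (Sum.inr ()) j =
      diagonal (Sum.elim d fun _ => (1 : F)) (Sum.inr ()) j := fun j => by
    rw [← mem_diagonalIsometries.1 hM, Matrix.mul_assoc, Matrix.mul_apply]
    simp [hcol, Pi.single_apply]
  have hblock : M = fromBlocks M.toBlocks₁₁ 0 0 1 := by
    ext (i | i) (j | j)
    · rfl
    · simp [hcol]
    · simp [hrow]
    · simp [hcol]
  exact ⟨_, fromBlocks_mem_diagonalIsometries.1 (hblock ▸ hM), hblock⟩

theorem card_diagonalIsometries_sum (h2 : (2 : F) ≠ 0) {d : ι → F} (hd : ∀ i, d i ≠ 0) :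
    Nat.card (diagonalIsometries (Sum.elim d fun _ : Unit => (1 : F))) =
      Nat.card {v : ι ⊕ Unit → F // ∑ i, Sum.elim d (fun _ => 1) i * v i ^ 2 = 1} *
        Nat.card (diagonalIsometries d) := by
  set D : ι ⊕ Unit → F := Sum.elim d fun _ => 1
  have hD0 : ∀ i, D i ≠ 0 := by
    rintro (i | i)
    · exact hd i
    · exact one_ne_zero
  have hQ : ∀ v : ι ⊕ Unit → F, ∑ i, D i * v i ^ 2 = v ⬝ᵥ diagonal D *ᵥ v := fun v => by
    simp only [dotProduct, mulVec_diagonal]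
    exact Finset.sum_congr rfl fun i _ => by ring
  set e : ι ⊕ Unit → F := Pi.single (Sum.inr ()) 1
  have he : e ⬝ᵥ diagonal D *ᵥ e = 1 := by simp [e, D]
  have htrans : ∀ v : {v : ι ⊕ Unit → F // ∑ i, D i * v i ^ 2 = 1},
      ∃ M ∈ diagonalIsometries D, M *ᵥ e = v := fun v =>
    exists_diagonalIsometry_mulVec_eq h2 D he ((hQ _).symm.trans v.2)
  choose g hg hge using htrans
  rw [← Nat.card_prod]
  symm
  refine Nat.card_eq_of_bijective (fun x => ⟨g x.1 * fromBlocks x.2.1 0 0 1,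
    mul_mem_diagonalIsometries (hg x.1) (fromBlocks_mem_diagonalIsometries.2 x.2.2)⟩) ⟨?_, ?_⟩
  · rintro ⟨v, N⟩ ⟨v', N'⟩ h
    have h := congrArg Subtype.val h
    dsimp only at h
    have hfix : ∀ N : Matrix ι ι F, fromBlocks N 0 0 (1 : Matrix Unit Unit F) *ᵥ e = e := by
      intro N
      ext (i | i) <;> simp [e, one_apply]
    have hv : v = v' := by
      have := congrArg (· *ᵥ e) h
      simp only [← mulVec_mulVec, hfix, hge] at this
      exact Subtype.ext this
    subst hv
    have hu := (isUnit_iff_isUnit_det _).2 (isUnit_det_of_mem_diagonalIsometries hD0 (hg v))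
    have := (fromBlocks_inj.1 (hu.mul_left_cancel h)).1
    rw [Subtype.ext this]
  · rintro ⟨M, hM⟩
    have hMe : ∑ i, D i * (M *ᵥ e) i ^ 2 = 1 := by
      have h : diagonal D *ᵥ e = Mᵀ *ᵥ (diagonal D *ᵥ (M *ᵥ e)) := by
        rw [mulVec_mulVec, mulVec_mulVec, mem_diagonalIsometries.1 hM]
      rw [hQ, ← he, h, dotProduct_mulVec e, vecMul_transpose]
    set v : {v : ι ⊕ Unit → F // ∑ i, D i * v i ^ 2 = 1} := ⟨M *ᵥ e, hMe⟩
    have hu := isUnit_det_of_mem_diagonalIsometries hD0 (hg v)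
    have hfix : ((g v)⁻¹ * M) *ᵥ e = e := by
      rw [← mulVec_mulVec, show M *ᵥ e = g v *ᵥ e from (hge v).symm, mulVec_mulVec,
        nonsing_inv_mul _ hu, one_mulVec]
    obtain ⟨N, hN, h⟩ := exists_fromBlocks_of_mulVec_single
      (mul_mem_diagonalIsometries (inv_mem_diagonalIsometries hu (hg v)) hM) hfix
    refine ⟨(v, ⟨N, hN⟩), Subtype.ext ?_⟩
    change g v * fromBlocks N 0 0 1 = M
    rw [← h, ← Matrix.mul_assoc, mul_nonsing_inv _ hu, Matrix.one_mul]

end Isometries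

section Counting

variable {F : Type*} [Field F] [Fintype F] [DecidableEq F]

theorem sum_quadraticChar_mul_sub (hF : ringChar F ≠ 2) (t : F) :
    ∑ a : F, quadraticChar F a * quadraticChar F (t - a) =
      quadraticChar F (-1) * ((if t = 0 then (Fintype.card F : ℤ) else 0) - 1) := by
  split_ifs with ht
  · subst ht
    have : ∀ a : F, quadraticChar F a * quadraticChar F (0 - a) =
        quadraticChar F (-1) * (1 - if a = 0 then 1 else 0) := fun a => by
      rw [zero_sub, neg_eq_neg_one_mul, map_mul, mul_left_comm, ← sq]
      split_ifs with ha
      · simp [ha]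
      · rw [quadraticChar_sq_one ha, sub_zero]
    simp_rw [this]
    rw [← Finset.mul_sum]
    simp
  · have hJ := jacobiSum_nontrivial_inv (quadraticChar_ne_one hF)
    rw [(quadraticChar_isQuadratic F).inv, jacobiSum] at hJ
    rw [← Equiv.sum_comp (Equiv.mulLeft₀ t ht)]
    have : ∀ a : F, quadraticChar F (t * a) * quadraticChar F (t - t * a) =
        quadraticChar F a * quadraticChar F (1 - a) := fun a => by
      rw [show t - t * a = t * (1 - a) by ring, map_mul, map_mul]
      linear_combination quadraticChar F a * quadraticChar F (1 - a) * quadraticChar_sq_one ht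
    simp only [Equiv.mulLeft₀_apply, this, hJ]
    ring

theorem card_sq_eq (hF : ringChar F ≠ 2) (a : F) :
    (Nat.card {x : F // x ^ 2 = a} : ℤ) = quadraticChar F a + 1 := by
  rw [← quadraticChar_card_sqrts hF a, Set.toFinset_card, ← Nat.card_eq_fintype_card]
  rfl

/-- The number of points of the conic `x² + d y² = t`. -/
theorem card_sq_add_mul_sq_eq (hF : ringChar F ≠ 2) {d : F} (hd : d ≠ 0) (t : F) :
    (Nat.card {x : F × F // x.1 ^ 2 + d * x.2 ^ 2 = t} : ℤ) =
      Fintype.card F + quadraticChar F (-d) *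
        ((if t = 0 then (Fintype.card F : ℤ) else 0) - 1) := by
  let e : {x : F × F // x.1 ^ 2 + d * x.2 ^ 2 = t} ≃
      Σ a : F, {x : F // x ^ 2 = a} × {y : F // y ^ 2 = d * (t - a)} :=
    { toFun := fun x => ⟨x.1.1 ^ 2, ⟨x.1.1, rfl⟩, ⟨d * x.1.2, by linear_combination d * x.2⟩⟩
      invFun := fun x => ⟨(x.2.1.1, d⁻¹ * x.2.2.1), by
        have h1 := x.2.1.2
        have h2 := x.2.2.2
        simp only [mul_pow, h1, h2]
        field_simp
        ring⟩
      left_inv := fun x => by ext <;> simp [hd]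
      right_inv := by
        rintro ⟨a, ⟨x, rfl⟩, ⟨y, hy⟩⟩
        simp [hd] }
  rw [Nat.card_congr e, Nat.card_sigma]
  push_cast [Nat.card_prod, card_sq_eq hF]
  have h : ∀ a : F, (quadraticChar F a + 1) * (quadraticChar F (d * (t - a)) + 1) =
      quadraticChar F d * (quadraticChar F a * quadraticChar F (t - a)) + quadraticChar F a +
        quadraticChar F (d * (t - a)) + 1 := fun a => by
    rw [map_mul]; ring
  have h0 : ∑ a : F, quadraticChar F (d * (t - a)) = 0 := by
    rw [← quadraticChar_sum_zero hF]
    exact ((Equiv.subLeft t).trans (Equiv.mulLeft₀ d hd)).sum_comp fun a => quadraticChar F a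
  simp_rw [h]
  rw [Finset.sum_add_distrib, Finset.sum_add_distrib, Finset.sum_add_distrib, h0,
    quadraticChar_sum_zero hF, ← Finset.mul_sum, sum_quadraticChar_mul_sub hF,
    neg_eq_neg_one_mul d, map_mul]
  simp
  ring

theorem card_add_sq_add_sq_eq (hF : ringChar F ≠ 2) {X : Type*} [Fintype X] (f : X → F) (c : F) :
    (Nat.card {x : X × F × F // f x.1 + (x.2.1 ^ 2 + x.2.2 ^ 2) = c} : ℤ) =
      (Fintype.card F - quadraticChar F (-1)) * Fintype.card X +
        Fintype.card F * quadraticChar F (-1) * Nat.card {x : X // f x = c} := by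
  let e : {x : X × F × F // f x.1 + (x.2.1 ^ 2 + x.2.2 ^ 2) = c} ≃
      Σ x : X, {y : F × F // y.1 ^ 2 + 1 * y.2 ^ 2 = c - f x} :=
    { toFun := fun x => ⟨x.1.1, x.1.2, by linear_combination x.2⟩
      invFun := fun x => ⟨(x.1, x.2.1), by
        have := x.2.2
        rw [one_mul] at this
        rw [this]; ring⟩
      left_inv := fun x => rfl
      right_inv := fun x => rfl }
  rw [Nat.card_congr e, Nat.card_sigma, Nat.card_eq_fintype_card, Fintype.card_subtype]
  push_cast [card_sq_add_mul_sq_eq hF one_ne_zero, Finset.card_filter]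
  simp_rw [sub_eq_zero, eq_comm (a := c)]
  rw [Finset.sum_add_distrib, ← Finset.mul_sum, Finset.sum_sub_distrib]
  have : ∀ x, (if f x = c then (Fintype.card F : ℤ) else 0) =
      Fintype.card F * if f x = c then 1 else 0 := fun x => by split_ifs <;> simp
  simp_rw [this]
  rw [← Finset.mul_sum]
  simp
  ring

end Counting

section OnesAndLast

variable {F : Type*} [Field F]

/-- The coefficients of the form `x₀² + ⋯ + xₖ₋₁² + δ xₖ²`. -/
def onesAndLast (δ : F) (k : ℕ) (i : Fin (k + 1)) : F :=
  if (i : ℕ) = k then δ else 1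

theorem onesAndLast_zero (δ : F) (k : ℕ) :
    onesAndLast δ (k + 1) 0 = 1 := by
  simp [onesAndLast]

theorem onesAndLast_succ (δ : F) (k : ℕ) (i : Fin (k + 1)) :
    onesAndLast δ (k + 1) i.succ = onesAndLast δ k i := by
  simp [onesAndLast]

theorem onesAndLast_ne_zero {δ : F} (hδ : δ ≠ 0) (k : ℕ)
    (i : Fin (k + 1)) : onesAndLast δ k i ≠ 0 := by
  rw [onesAndLast]
  split_ifs
  exacts [hδ, one_ne_zero]

/-- The number of vectors of norm one for the form `x₀² + ⋯ + xₖ₋₁² + δ xₖ²`. -/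
noncomputable def unitSphereCard (δ : F) (k : ℕ) : ℕ :=
  Nat.card {v : Fin (k + 1) → F // ∑ i, onesAndLast δ k i * v i ^ 2 = 1}

theorem card_diagonalIsometries_onesAndLast_succ (hF : ringChar F ≠ 2) {δ : F} (hδ : δ ≠ 0)
    (k : ℕ) :
    Nat.card (diagonalIsometries (onesAndLast δ (k + 1))) =
      unitSphereCard δ (k + 1) * Nat.card (diagonalIsometries (onesAndLast δ k)) := by
  let e : Fin (k + 2) ≃ Fin (k + 1) ⊕ Unit :=
    (finSuccEquiv (k + 1)).trans (Equiv.optionEquivSumPUnit _)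
  have he : (Sum.elim (onesAndLast δ k) fun _ => (1 : F)) ∘ e = onesAndLast δ (k + 1) := by
    ext i
    refine Fin.cases ?_ (fun i => ?_) i
    · simp [e, onesAndLast_zero]
    · simp [e, onesAndLast_succ]
  rw [← he, card_diagonalIsometries_comp,
    card_diagonalIsometries_sum (Ring.two_ne_zero hF) (onesAndLast_ne_zero hδ k)]
  congr 1
  rw [unitSphereCard, ← he]
  refine Nat.card_congr ((e.symm.arrowCongr (Equiv.refl F)).subtypeEquiv fun v => ?_)
  rw [← e.sum_comp]
  rfl

variable [Fintype F] [DecidableEq F]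

theorem unitSphereCard_zero {δ : F} (hδ : quadraticChar F δ = -1) :
    unitSphereCard δ 0 = 0 := by
  have : IsEmpty {v : Fin 1 → F // ∑ i, onesAndLast δ 0 i * v i ^ 2 = 1} := by
    refine ⟨fun ⟨v, hv⟩ => ?_⟩
    rw [Fin.sum_univ_one] at hv
    simp only [onesAndLast, Fin.val_zero, if_true] at hv
    have h := congrArg (quadraticChar F) hv
    rw [map_mul, map_pow, map_one, hδ] at h
    nlinarith [sq_nonneg (quadraticChar F (v 0))]
  exact Nat.card_of_isEmpty

theorem unitSphereCard_one (hF : ringChar F ≠ 2) {δ : F} (hδ : quadraticChar F δ = -1) :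
    (unitSphereCard δ 1 : ℤ) = Fintype.card F + quadraticChar F (-1) := by
  have hδ0 : δ ≠ 0 := by
    rintro rfl
    simp at hδ
  have h := card_sq_add_mul_sq_eq hF hδ0 1
  rw [if_neg one_ne_zero, neg_eq_neg_one_mul δ, map_mul, hδ] at h
  have e : Nat.card {v : Fin 2 → F // ∑ i, onesAndLast δ 1 i * v i ^ 2 = 1} =
      Nat.card {x : F × F // x.1 ^ 2 + δ * x.2 ^ 2 = 1} :=
    Nat.card_congr ((finTwoArrowEquiv F).subtypeEquiv fun v => by
      simp [Fin.sum_univ_two, onesAndLast, finTwoArrowEquiv])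
  rw [unitSphereCard, e, h]
  ring

theorem unitSphereCard_add_two (hF : ringChar F ≠ 2) (δ : F) (k : ℕ) :
    (unitSphereCard δ (k + 2) : ℤ) =
      (Fintype.card F - quadraticChar F (-1)) * Fintype.card F ^ (k + 1) +
        Fintype.card F * quadraticChar F (-1) * unitSphereCard δ k := by
  have h := card_add_sq_add_sq_eq hF
    (fun v : Fin (k + 1) → F => ∑ i, onesAndLast δ k i * v i ^ 2) 1
  rw [unitSphereCard, unitSphereCard]
  rw [Fintype.card_fun, Fintype.card_fin] at h
  push_cast at h
  rw [← h]
  congr 1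
  let e : (Fin (k + 3) → F) ≃ (Fin (k + 1) → F) × F × F :=
    { toFun := fun v => (fun i => v i.succ.succ, v 0, v 1)
      invFun := fun x => Fin.cons x.2.1 (Fin.cons x.2.2 x.1)
      left_inv := fun v => by
        ext i
        refine Fin.cases rfl (fun i => ?_) i
        refine Fin.cases rfl (fun i => rfl) i
      right_inv := fun x => rfl }
  refine Nat.card_congr (e.subtypeEquiv fun v => ?_)
  change _ ↔ ∑ i, onesAndLast δ k i * v i.succ.succ ^ 2 +
    (v 0 ^ 2 + v (Fin.succ 0) ^ 2) = 1
  rw [Fin.sum_univ_succ, Fin.sum_univ_succ]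
  simp only [onesAndLast_succ, onesAndLast_zero, one_mul]
  rw [show ∀ a b c : F, a + (b + c) = c + (a + b) from fun a b c => by ring]

theorem unitSphereCard_two_mul (hF : ringChar F ≠ 2) {δ : F} (hδ : quadraticChar F δ = -1)
    (j : ℕ) :
    (unitSphereCard δ (2 * j) : ℤ) =
      Fintype.card F ^ j * (Fintype.card F ^ j - quadraticChar F (-1) ^ j) := by
  induction j with
  | zero => simp [unitSphereCard_zero hδ]
  | succ j ih =>
    rw [Nat.mul_succ, unitSphereCard_add_two hF, ih]
    ring

theorem unitSphereCard_two_mul_add_one (hF : ringChar F ≠ 2) {δ : F}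
    (hδ : quadraticChar F δ = -1) (j : ℕ) :
    (unitSphereCard δ (2 * j + 1) : ℤ) =
      Fintype.card F ^ j * (Fintype.card F ^ (j + 1) + quadraticChar F (-1) ^ (j + 1)) := by
  induction j with
  | zero => simp [unitSphereCard_one hF hδ]
  | succ j ih =>
    rw [show 2 * (j + 1) + 1 = 2 * j + 1 + 2 by ring, unitSphereCard_add_two hF, ih]
    ring

theorem card_diagonalIsometries_onesAndLast_zero (hF : ringChar F ≠ 2) {δ : F} (hδ : δ ≠ 0) :
    Nat.card (diagonalIsometries (onesAndLast δ 0)) = 2 := by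
  have h := card_sq_eq hF (1 : F)
  rw [map_one] at h
  have e : Nat.card (diagonalIsometries (onesAndLast δ 0)) = Nat.card {x : F // x ^ 2 = 1} := by
    refine Nat.card_congr ((uniqueRingEquiv (m := Fin 1) (A := F)).toEquiv.subtypeEquiv fun M => ?_)
    have h : M ∈ diagonalIsometries (onesAndLast δ 0) ↔ M 0 0 * δ * M 0 0 = δ := by
      rw [mem_diagonalIsometries, ← Matrix.ext_iff]
      simp [Matrix.mul_apply, onesAndLast]
    change _ ↔ M 0 0 ^ 2 = 1
    rw [h]
    exact ⟨fun h => mul_left_cancel₀ hδ (by linear_combination h),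
      fun h => by linear_combination δ * h⟩
  rw [e]
  exact_mod_cast h

theorem card_diagonalIsometries_onesAndLast (hF : ringChar F ≠ 2) {δ : F}
    (hδ : quadraticChar F δ = -1) (j : ℕ) :
    (Nat.card (diagonalIsometries (onesAndLast δ (2 * j + 1))) : ℤ) =
      2 * (Fintype.card F : ℤ) ^ (j * (j + 1)) *
        ((Fintype.card F : ℤ) ^ (j + 1) + quadraticChar F (-1) ^ (j + 1)) *
        ∏ r ∈ Finset.Icc 1 j, ((Fintype.card F : ℤ) ^ (2 * r) - 1) := by
  have hδ0 : δ ≠ 0 := by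
    rintro rfl
    simp at hδ
  have hη : ∀ n : ℕ, (quadraticChar F (-1) ^ n) ^ 2 = 1 := fun n => by
    rw [pow_right_comm, quadraticChar_sq_one (neg_ne_zero.2 one_ne_zero), one_pow]
  induction j with
  | zero =>
    rw [mul_zero, card_diagonalIsometries_onesAndLast_succ hF hδ0,
      card_diagonalIsometries_onesAndLast_zero hF hδ0]
    push_cast
    rw [unitSphereCard_one hF hδ]
    simp
    ring
  | succ j ih =>
    rw [card_diagonalIsometries_onesAndLast_succ hF hδ0,
      show 2 * (j + 1) = 2 * j + 1 + 1 by ring, card_diagonalIsometries_onesAndLast_succ hF hδ0]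
    push_cast
    rw [ih, show 2 * j + 1 + 1 = 2 * (j + 1) by ring, unitSphereCard_two_mul_add_one hF hδ,
      unitSphereCard_two_mul hF hδ, Finset.prod_Icc_succ_top (by omega)]
    rw [show (Fintype.card F : ℤ) ^ (2 * (j + 1)) - 1 =
      ((Fintype.card F : ℤ) ^ (j + 1) - quadraticChar F (-1) ^ (j + 1)) *
        ((Fintype.card F : ℤ) ^ (j + 1) + quadraticChar F (-1) ^ (j + 1)) by
      rw [← hη (j + 1)]; ring]
    ring

end OnesAndLast

theorem stmt_4 (p : ℕ) (hp : p.Prime) (hp2 : p ≠ 2) (m : ℕ) (hm : 2 ≤ m) (heven : Even m)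
    (δ : ZMod p) (hδunit : IsUnit δ) (hδ : ¬∃ x : ZMod p, x ^ 2 = δ) :
    (Nat.card {γ : GL (Fin m) (ZMod p) //
        (γ : Matrix (Fin m) (Fin m) (ZMod p))ᵀ *
          Matrix.diagonal (fun i : Fin m => if (i : ℕ) = m - 1 then δ else 1) *
          (γ : Matrix (Fin m) (Fin m) (ZMod p)) =
          Matrix.diagonal (fun i : Fin m => if (i : ℕ) = m - 1 then δ else 1)} : ℤ) =
      2 * (p : ℤ) ^ ((m ^ 2 - 2 * m) / 4) *
        ((p : ℤ) ^ (m / 2) + ((-1 : ℤ) ^ ((p - 1) / 2)) ^ (m / 2)) *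
        ∏ r ∈ Finset.Icc 1 (m / 2 - 1), ((p : ℤ) ^ (2 * r) - 1) := by
  have : Fact p.Prime := ⟨hp⟩
  obtain ⟨j, rfl⟩ : ∃ j, m = 2 * j + 1 + 1 := by
    obtain ⟨n, rfl⟩ := heven
    exact ⟨n - 1, by omega⟩
  have hF : ringChar (ZMod p) ≠ 2 := by rwa [ZMod.ringChar_zmod_n]
  have hχ : quadraticChar (ZMod p) δ = -1 := by
    rw [quadraticChar_neg_one_iff_not_isSquare]
    rintro ⟨x, hx⟩
    exact hδ ⟨x, by rw [hx, sq]⟩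
  have hη : quadraticChar (ZMod p) (-1) = (-1) ^ ((p - 1) / 2) := by
    have hodd : p % 2 = 1 := hp.eq_two_or_odd.resolve_left hp2
    rw [quadraticChar_neg_one hF, ZMod.card, ZMod.χ₄_eq_neg_one_pow hodd]
    congr 1
    omega
  have h := card_diagonalIsometries_onesAndLast hF hχ j
  rw [← card_GL_preserving_diagonal (onesAndLast_ne_zero hδunit.ne_zero _), ZMod.card, hη] at h
  have hexp : ((2 * j + 1 + 1) ^ 2 - 2 * (2 * j + 1 + 1)) / 4 = j * (j + 1) := by
    have : (2 * j + 1 + 1) ^ 2 = 4 * (j * (j + 1)) + 2 * (2 * j + 1 + 1) := by ring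
    omega
  rw [hexp, show (2 * j + 1 + 1) / 2 = j + 1 by omega]
  exact h
end

section
/- Let p be an odd prime and let m ≤ l be natural numbers with m even and m ≥ 2. Let N(l, m) be the number of symmetric l×l matrices u over 𝔽_p with rank u = m. Then N(l, m) · ∏_{r=1}^{m/2} (p^{2r} − 1) = p^{m(m+2)/4} · ∏_{r=l−m+1}^{l} (p^r − 1). (Equivalently, N(l, m) = p^{m(m+2)/4} · ∏_{r=l−m+1}^{l} (p^r − 1) / ∏_{r=1}^{m/2} (p^{2r} − 1).) -/
open Matrix

theorem rank_eq_rank_succ_rows {K : Type*} [Field K] {k n : ℕ}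
    (M : Matrix (Fin (n + 1)) (Fin k) K)
    [Decidable (∃ w, w ᵥ* M.submatrix Fin.succ id = M 0)] :
    M.rank = (M.submatrix Fin.succ id).rank +
      if ∃ w, w ᵥ* M.submatrix Fin.succ id = M 0 then 0 else 1 := by
  have hmem : (∃ w, w ᵥ* M.submatrix Fin.succ id = M 0) ↔
      M 0 ∈ Submodule.span K (Set.range (M.submatrix Fin.succ id).row) := by
    rw [← range_vecMulLinear]
    simp [LinearMap.mem_range]
  have hrange : Set.range M.row = Set.range (M.submatrix Fin.succ id).row ∪ {M 0} := by
    ext x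
    simp only [Set.mem_range, Fin.exists_fin_succ, Set.mem_union, Set.mem_singleton_iff]
    rw [or_comm]
    exact or_congr Iff.rfl eq_comm
  rw [Matrix.rank_eq_finrank_span_row, Matrix.rank_eq_finrank_span_row, hrange,
    Submodule.span_union]
  split_ifs with h <;> rw [hmem] at h
  · rw [sup_eq_left.2 (by simpa using h), add_zero]
  · exact Submodule.finrank_sup_span_singleton h

/-- The matrix obtained from `B` by adding a first row and column `v` with corner `a`. -/
def bordered {K : Type*} {n : ℕ} (a : K) (v : Fin n → K) (B : Matrix (Fin n) (Fin n) K) :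
    Matrix (Fin (n + 1)) (Fin (n + 1)) K :=
  Matrix.of fun i j => Fin.cases (motive := fun _ => K)
    (Fin.cases (motive := fun _ => K) a v j)
    (fun i => Fin.cases (motive := fun _ => K) (v i) (B i) j) i

section bordered

variable {K : Type*} {n : ℕ} (a : K) (v : Fin n → K) (B : Matrix (Fin n) (Fin n) K) (i j : Fin n)

@[simp] theorem bordered_zero_zero : bordered a v B 0 0 = a := rfl

@[simp] theorem bordered_zero_succ : bordered a v B 0 j.succ = v j := rfl

@[simp] theorem bordered_succ_zero : bordered a v B i.succ 0 = v i := rfl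

@[simp] theorem bordered_succ_succ : bordered a v B i.succ j.succ = B i j := rfl

theorem rank_bordered_submatrix_succ [Field K] [Decidable (∃ w, w ᵥ* B = v)] (hB : Bᵀ = B) :
    ((bordered a v B).submatrix Fin.succ id).rank = B.rank + if ∃ w, w ᵥ* B = v then 0 else 1 := by
  have hT : (((bordered a v B).submatrix Fin.succ id)ᵀ).submatrix Fin.succ id = B := by
    ext i j
    exact congrFun (congrFun hB i) j
  have h0 : ((bordered a v B).submatrix Fin.succ id)ᵀ 0 = v := rfl
  classical
  rw [← Matrix.rank_transpose, rank_eq_rank_succ_rows]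
  simp only [hT, h0]

theorem vecMul_bordered_submatrix_succ_eq_iff [Field K] (w : Fin n → K) :
    w ᵥ* (bordered a v B).submatrix Fin.succ id = bordered a v B 0 ↔ w ⬝ᵥ v = a ∧ w ᵥ* B = v := by
  simp only [funext_iff, Fin.forall_fin_succ]
  exact Iff.rfl

variable {v B}

theorem rank_bordered_of_notMem [Field K] (hB : Bᵀ = B) (hv : ¬ ∃ w, w ᵥ* B = v) :
    (bordered a v B).rank = B.rank + 2 := by
  classical
  rw [rank_eq_rank_succ_rows, rank_bordered_submatrix_succ a v B hB, if_neg hv, if_neg]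
  rintro ⟨w, hw⟩
  exact hv ⟨w, ((vecMul_bordered_submatrix_succ_eq_iff a v B w).1 hw).2⟩

theorem rank_bordered_of_vecMul_eq [Field K] [DecidableEq K] (hB : Bᵀ = B) {w : Fin n → K}
    (hw : w ᵥ* B = v) :
    (bordered a v B).rank = B.rank + if a = w ⬝ᵥ v then 0 else 1 := by
  classical
  rw [rank_eq_rank_succ_rows, rank_bordered_submatrix_succ a v B hB, if_pos ⟨w, hw⟩, add_zero]
  congr 1
  refine if_congr ⟨?_, ?_⟩ rfl rfl
  · rintro ⟨u, hu⟩
    obtain ⟨h1, h2⟩ := (vecMul_bordered_submatrix_succ_eq_iff a v B u).1 hu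
    rw [← h1, ← hw, ← Matrix.mulVec_transpose B w, hB, Matrix.dotProduct_mulVec, h2, hw.symm,
      ← Matrix.mulVec_transpose B w, hB, dotProduct_comm]
  · intro h
    exact ⟨w, (vecMul_bordered_submatrix_succ_eq_iff a v B w).2 ⟨h.symm, hw⟩⟩

end bordered

/-- A symmetric matrix of size `n + 1` is a bordered symmetric matrix of size `n`. -/
def borderedEquiv (K : Type*) (n : ℕ) :
    {B : Matrix (Fin n) (Fin n) K // Bᵀ = B} × (Fin n → K) × K ≃
      {u : Matrix (Fin (n + 1)) (Fin (n + 1)) K // uᵀ = u} where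
  toFun x := ⟨bordered x.2.2 x.2.1 x.1.1, by
    ext i j
    refine Fin.cases ?_ (fun i => ?_) i <;> refine Fin.cases ?_ (fun j => ?_) j <;>
      simp only [transpose_apply, bordered_zero_zero, bordered_zero_succ, bordered_succ_zero,
        bordered_succ_succ]
    exact congrFun (congrFun x.1.2 i) j⟩
  invFun u := ⟨⟨u.1.submatrix Fin.succ Fin.succ, by
    rw [transpose_submatrix, u.2]⟩, fun i => u.1 0 i.succ, u.1 0 0⟩
  left_inv x := rfl
  right_inv u := by
    ext i j
    refine Fin.cases ?_ (fun i => ?_) i <;> refine Fin.cases ?_ (fun j => ?_) j <;> try rfl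
    exact congrFun (congrFun u.2 i.succ) 0

theorem card_vecMul_range {K : Type*} [Field K] [Fintype K] {n : ℕ}
    (B : Matrix (Fin n) (Fin n) K) [DecidablePred fun v => ∃ w, w ᵥ* B = v] :
    (Finset.univ.filter fun v => ∃ w, w ᵥ* B = v).card = Fintype.card K ^ B.rank := by
  classical
  rw [Matrix.rank_eq_finrank_span_row, ← range_vecMulLinear,
    ← Module.card_eq_pow_finrank (K := K), Fintype.card_subtype]
  congr 1
  ext v
  simp [LinearMap.mem_range]

theorem sum_rank_bordered_eq {K : Type*} [Field K] [Fintype K] {n : ℕ} (r : ℕ)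
    {B : Matrix (Fin n) (Fin n) K} (hB : Bᵀ = B) {q : ℚ} (hq : q = Fintype.card K) :
    (∑ v : Fin n → K, ∑ a : K, if (bordered a v B).rank = r then (1 : ℚ) else 0) =
      q ^ B.rank * (if B.rank = r then 1 else 0) +
      (q - 1) * q ^ B.rank * (if B.rank + 1 = r then 1 else 0) +
      (q ^ n - q ^ B.rank) * q * (if B.rank + 2 = r then 1 else 0) := by
  classical
  have key : ∀ v : Fin n → K,
      (∑ a : K, if (bordered a v B).rank = r then (1 : ℚ) else 0) =
      (if ∃ w, w ᵥ* B = v then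
        ((if B.rank = r then 1 else 0) + (q - 1) * if B.rank + 1 = r then 1 else 0) -
          q * (if B.rank + 2 = r then 1 else 0) else 0) +
        q * if B.rank + 2 = r then 1 else 0 := by
    intro v
    by_cases hv : ∃ w, w ᵥ* B = v
    · rw [if_pos hv]
      obtain ⟨w, hw⟩ := hv
      have : ∀ a, (if (bordered a v B).rank = r then (1 : ℚ) else 0) =
          (if a = w ⬝ᵥ v then
            (if B.rank = r then 1 else 0) - (if B.rank + 1 = r then 1 else 0) else 0) +
            (if B.rank + 1 = r then 1 else 0) := by
        intro a
        rw [rank_bordered_of_vecMul_eq a hB hw]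
        by_cases ha : a = w ⬝ᵥ v <;> simp [ha]
      simp only [this, Finset.sum_add_distrib, Finset.sum_ite_eq', Finset.mem_univ, if_true,
        Finset.sum_const, Finset.card_univ, nsmul_eq_mul, ← hq]
      ring
    · rw [if_neg hv]
      simp only [rank_bordered_of_notMem _ hB hv, Finset.sum_const, Finset.card_univ,
        nsmul_eq_mul, ← hq, zero_add]
  rw [Finset.sum_congr rfl fun v _ => key v, Finset.sum_add_distrib, ← Finset.sum_filter,
    Finset.sum_const, Finset.sum_const, card_vecMul_range]
  simp only [nsmul_eq_mul, Finset.card_univ, Fintype.card_pi, Finset.prod_const, Fintype.card_fin]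
  push_cast
  rw [← hq]
  ring

/-- The number of symmetric matrices of size `n` and rank `r` over `K`. -/
noncomputable def symmRankCount (K : Type*) [Field K] (n r : ℕ) : ℕ :=
  Nat.card {u : Matrix (Fin n) (Fin n) K // uᵀ = u ∧ u.rank = r}

section count

variable (K : Type*) [Field K] [Fintype K] [DecidableEq K] (n : ℕ) {q : ℚ}

theorem symmRankCount_eq_sum (r : ℕ) :
    (symmRankCount K n r : ℚ) =
      ∑ B : {B : Matrix (Fin n) (Fin n) K // Bᵀ = B}, if B.1.rank = r then 1 else 0 := by
  rw [Finset.sum_boole, symmRankCount, ← Fintype.card_subtype, ← Nat.card_eq_fintype_card]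
  congr 1
  exact Nat.card_congr (Equiv.subtypeSubtypeEquivSubtypeInter _
    fun u : Matrix (Fin n) (Fin n) K => u.rank = r).symm

theorem symmRankCount_succ_eq_sum (hq : q = Fintype.card K) (r : ℕ) :
    (symmRankCount K (n + 1) r : ℚ) = ∑ B : {B : Matrix (Fin n) (Fin n) K // Bᵀ = B},
      (q ^ B.1.rank * (if B.1.rank = r then 1 else 0) +
      (q - 1) * q ^ B.1.rank * (if B.1.rank + 1 = r then 1 else 0) +
      (q ^ n - q ^ B.1.rank) * q * (if B.1.rank + 2 = r then 1 else 0)) := by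
  rw [symmRankCount_eq_sum, ← (borderedEquiv K n).sum_comp, Fintype.sum_prod_type]
  refine Finset.sum_congr rfl fun B _ => ?_
  rw [← sum_rank_bordered_eq r B.2 hq, Fintype.sum_prod_type]
  rfl

theorem symmRankCount_succ_zero (hq : q = Fintype.card K) :
    (symmRankCount K (n + 1) 0 : ℚ) = symmRankCount K n 0 := by
  rw [symmRankCount_succ_eq_sum K n hq, symmRankCount_eq_sum]
  refine Finset.sum_congr rfl fun B _ => ?_
  by_cases h : B.1.rank = 0 <;> simp [h]

theorem symmRankCount_succ_one (hq : q = Fintype.card K) :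
    (symmRankCount K (n + 1) 1 : ℚ) =
      q * symmRankCount K n 1 + (q - 1) * symmRankCount K n 0 := by
  rw [symmRankCount_succ_eq_sum K n hq, symmRankCount_eq_sum, symmRankCount_eq_sum,
    Finset.mul_sum, Finset.mul_sum, ← Finset.sum_add_distrib]
  refine Finset.sum_congr rfl fun B _ => ?_
  by_cases h : B.1.rank = 0
  · simp [h]
  · by_cases h1 : B.1.rank = 1 <;> simp [h, h1]

theorem symmRankCount_succ_add_two (hq : q = Fintype.card K) (r : ℕ) :
    (symmRankCount K (n + 1) (r + 2) : ℚ) =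
      q ^ (r + 2) * symmRankCount K n (r + 2) + (q - 1) * q ^ (r + 1) * symmRankCount K n (r + 1) +
        (q ^ n - q ^ r) * q * symmRankCount K n r := by
  simp only [symmRankCount_succ_eq_sum K n hq, symmRankCount_eq_sum,
    Finset.mul_sum, ← Finset.sum_add_distrib]
  refine Finset.sum_congr rfl fun B _ => ?_
  by_cases h : B.1.rank = r
  · simp [h]
  · by_cases h1 : B.1.rank = r + 1
    · simp [h1]
    · by_cases h2 : B.1.rank = r + 2 <;> simp [h, h1, h2]

theorem symmRankCount_zero (r : ℕ) : (symmRankCount K 0 r : ℚ) = if r = 0 then 1 else 0 := by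
  have : Unique {B : Matrix (Fin 0) (Fin 0) K // Bᵀ = B} :=
    { default := ⟨0, rfl⟩, uniq := fun _ => Subtype.ext (Subsingleton.elim _ _) }
  rw [symmRankCount_eq_sum, Fintype.sum_unique]
  have h : ∀ B : Matrix (Fin 0) (Fin 0) K, B.rank = 0 := fun B => by simp [Subsingleton.elim B 0]
  rw [h]
  simp [eq_comm]

/-- The product of `x / q ^ i - 1` over `i < r`. -/
def fallingProd (q x : ℚ) (r : ℕ) : ℚ := ∏ i ∈ Finset.range r, (x / q ^ i - 1)

theorem fallingProd_succ (q x : ℚ) (r : ℕ) :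
    fallingProd q x (r + 1) = fallingProd q x r * (x / q ^ r - 1) :=
  Finset.prod_range_succ ..

theorem fallingProd_mul_succ {q : ℚ} (hq : q ≠ 0) (x : ℚ) (r : ℕ) :
    fallingProd q (x * q) (r + 1) = (x * q - 1) * fallingProd q x r := by
  rw [fallingProd, Finset.prod_range_succ', mul_comm, pow_zero, div_one]
  congr 1
  refine Finset.prod_congr rfl fun i _ => ?_
  rw [pow_succ, mul_div_mul_right _ _ hq]

/-- The product of `q ^ (2 * i) / (q ^ (2 * i) - 1)` over `1 ≤ i ≤ s`. -/
def evenProd (q : ℚ) (s : ℕ) : ℚ :=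
  ∏ i ∈ Finset.range s, q ^ (2 * (i + 1)) / (q ^ (2 * (i + 1)) - 1)

theorem evenProd_succ (q : ℚ) (s : ℕ) :
    evenProd q (s + 1) = evenProd q s * (q ^ (2 * (s + 1)) / (q ^ (2 * (s + 1)) - 1)) :=
  Finset.prod_range_succ ..

theorem symmRankCount_eq (hq : q = Fintype.card K) (r : ℕ) :
    (symmRankCount K n r : ℚ) = evenProd q (r / 2) * fallingProd q (q ^ n) r := by
  have hq1 : 1 < q := by
    rw [hq]
    exact_mod_cast Fintype.one_lt_card
  have hq0 : q ≠ 0 := by positivity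
  induction n generalizing r with
  | zero =>
    rw [symmRankCount_zero]
    cases r with
    | zero => simp [evenProd, fallingProd]
    | succ r => simp [fallingProd, Finset.prod_range_succ']
  | succ n ih =>
    rcases r with _ | _ | r
    · rw [symmRankCount_succ_zero K n hq, ih]
      simp [fallingProd]
    · rw [zero_add, symmRankCount_succ_one K n hq, ih, ih]
      simp [fallingProd, evenProd]
      ring
    · rw [symmRankCount_succ_add_two K n hq, ih, ih, ih, pow_succ q n,
        fallingProd_mul_succ hq0]
      simp only [fallingProd_succ]
      have hpos : ∀ k, q ^ k ≠ 0 := fun k => pow_ne_zero k hq0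
      have hne : ∀ s, q ^ (2 * (s + 1)) - 1 ≠ 0 := fun s =>
        (sub_pos.2 (one_lt_pow₀ hq1 (by omega))).ne'
      obtain ⟨s, rfl | rfl⟩ := Nat.even_or_odd' r
      · rw [show (2 * s + 1 + 1) / 2 = s + 1 by omega,
          show (2 * s + 1) / 2 = s by omega, show 2 * s / 2 = s by omega, evenProd_succ]
        have h1 := hne s
        have h2 := hpos (2 * s)
        simp only [mul_add, mul_one, pow_add, pow_one] at h1 ⊢
        generalize q ^ (2 * s) = y at *
        generalize q ^ n = x at *
        field_simp
        ring
      · rw [show (2 * s + 1 + 1 + 1) / 2 = s + 1 by omega, show (2 * s + 1 + 1) / 2 = s + 1 by omega,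
          show (2 * s + 1) / 2 = s by omega, evenProd_succ]
        have h1 := hne s
        have h2 := hpos (2 * s)
        simp only [mul_add, mul_one, pow_add, pow_one] at h1 ⊢
        generalize q ^ (2 * s) = y at *
        generalize q ^ n = x at *
        field_simp
        ring

end count

theorem fallingProd_pow_eq {q : ℚ} (hq : q ≠ 0) {l m : ℕ} (hml : m ≤ l) :
    fallingProd q (q ^ l) m = ∏ r ∈ Finset.Icc (l - m + 1) l, (q ^ r - 1) := by
  refine Finset.prod_bij' (fun i _ => l - i) (fun i _ => l - i) ?_ ?_ ?_ ?_ ?_ <;>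
    simp only [Finset.mem_range, Finset.mem_Icc]
  · intros; omega
  · intros; omega
  · intros; omega
  · intros; omega
  · intro i hi
    rw [pow_sub₀ q hq (by omega), div_eq_mul_inv]

theorem evenProd_mul_prod {q : ℚ} (hq : 1 < q) (s : ℕ) :
    evenProd q s * ∏ r ∈ Finset.Icc 1 s, (q ^ (2 * r) - 1) = q ^ (s * (s + 1)) := by
  induction s with
  | zero => simp [evenProd]
  | succ s ih =>
    have h : q ^ (2 * (s + 1)) - 1 ≠ 0 := (sub_pos.2 (one_lt_pow₀ hq (by omega))).ne'
    rw [evenProd_succ, Finset.prod_Icc_succ_top (by omega), mul_mul_mul_comm, ih,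
      div_mul_cancel₀ _ h, ← pow_add]
    congr 1
    ring

theorem stmt_5 (p : ℕ) (hp : p.Prime) (hp2 : p ≠ 2) (l m : ℕ) (hml : m ≤ l)
    (hm : 2 ≤ m) (heven : Even m) :
    Nat.card {u : Matrix (Fin l) (Fin l) (ZMod p) // uᵀ = u ∧ u.rank = m} *
        ∏ r ∈ Finset.Icc 1 (m / 2), (p ^ (2 * r) - 1) =
      p ^ (m * (m + 2) / 4) * ∏ r ∈ Finset.Icc (l - m + 1) l, (p ^ r - 1) := by
  have : Fact p.Prime := ⟨hp⟩
  have hcount := symmRankCount_eq (ZMod p) l (q := p) (by rw [ZMod.card]) m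
  have hcast : ∀ k, ((p ^ k - 1 : ℕ) : ℚ) = (p : ℚ) ^ k - 1 := fun k => by
    rw [Nat.cast_sub (Nat.one_le_pow _ _ hp.pos)]
    push_cast
    rfl
  have hp1 : (1 : ℚ) < p := by exact_mod_cast hp.one_lt
  have hexp : m * (m + 2) / 4 = m / 2 * (m / 2 + 1) := by
    obtain ⟨s, rfl⟩ := heven
    rw [show (s + s) / 2 = s by omega, show (s + s) * (s + s + 2) = 4 * (s * (s + 1)) by ring]
    simp
  rw [symmRankCount] at hcount
  rw [← Nat.cast_inj (R := ℚ)]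
  simp only [Nat.cast_mul, Nat.cast_prod, hcast, Nat.cast_pow]
  rw [hcount, mul_right_comm, evenProd_mul_prod hp1, hexp, fallingProd_pow_eq (by positivity) hml]
end

section
/- Let p be an odd prime and let m ≤ l be natural numbers with m odd. Let N(l, m) be the number of symmetric l×l matrices u over 𝔽_p with rank u = m. Then N(l, m) · ∏_{r=1}^{(m−1)/2} (p^{2r} − 1) = p^{(m²−1)/4} · ∏_{r=l−m+1}^{l} (p^r − 1). (Equivalently, N(l, m) = p^{(m²−1)/4} · ∏_{r=l−m+1}^{l} (p^r − 1) / ∏_{r=1}^{(m−1)/2} (p^{2r} − 1).) -/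
open Matrix

namespace Matrix

section Border

variable {R n : Type*}

/-- The square matrix obtained from `u` by adding a last column and a last row, both equal to `b`,
with corner entry `a`. -/
def symmBorder (u : Matrix n n R) (b : n → R) (a : R) : Matrix (n ⊕ Unit) (n ⊕ Unit) R :=
  fromBlocks u (replicateCol Unit b) (replicateRow Unit b) (of fun _ _ ↦ a)

lemma symmBorder_eq_fromCols (u : Matrix n n R) (b : n → R) (a : R) :
    symmBorder u b a = fromCols (fromRows u (replicateRow Unit b))
      (replicateCol Unit (Sum.elim b fun _ ↦ a)) := by
  ext (i | i) (j | j) <;> rfl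

lemma fromRows_replicateRow_eq_transpose {u : Matrix n n R} (hu : u.IsSymm) (b : n → R) :
    fromRows u (replicateRow Unit b) = (fromCols u (replicateCol Unit b))ᵀ := by
  rw [transpose_fromCols, hu.eq, transpose_replicateCol]

lemma IsSymm.symmBorder {u : Matrix n n R} (hu : u.IsSymm) (b : n → R) (a : R) :
    (u.symmBorder b a).IsSymm :=
  hu.fromBlocks (transpose_replicateCol b) rfl

variable (R n) in
/-- A symmetric matrix indexed by `n ⊕ Unit` is a symmetric matrix indexed by `n` with a border. -/
def symmBorderEquiv :
    {u : Matrix n n R // u.IsSymm} × (n → R) × R ≃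
      {u : Matrix (n ⊕ Unit) (n ⊕ Unit) R // u.IsSymm} where
  toFun t := ⟨symmBorder t.1.1 t.2.1 t.2.2, t.1.2.symmBorder t.2.1 t.2.2⟩
  invFun u := ⟨⟨u.1.toBlocks₁₁, IsSymm.ext fun i j ↦ u.2.apply (Sum.inl i) (Sum.inl j)⟩,
    fun i ↦ u.1 (Sum.inl i) (Sum.inr ()), u.1 (Sum.inr ()) (Sum.inr ())⟩
  left_inv _ := rfl
  right_inv u := by
    ext (i | i) (j | j)
    · rfl
    · rfl
    · exact u.2.apply (Sum.inr ()) (Sum.inl j)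
    · rfl

end Border

section Rank

variable {K m n : Type*} [Field K] [Fintype n]

lemma range_mulVecLin_fromCols_replicateCol (A : Matrix m n K) (c : m → K) :
    LinearMap.range (fromCols A (replicateCol Unit c)).mulVecLin =
      LinearMap.range A.mulVecLin ⊔ Submodule.span K {c} := by
  have h : Set.range (fromCols A (replicateCol Unit c)).col = Set.range A.col ∪ {c} := by
    ext v
    simp only [Set.mem_range, Sum.exists, Set.mem_union, Set.mem_singleton_iff]
    refine or_congr Iff.rfl ⟨?_, ?_⟩
    · rintro ⟨_, rfl⟩
      rfl
    · rintro rfl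
      exact ⟨(), rfl⟩
  rw [range_mulVecLin, range_mulVecLin, h, Submodule.span_union]

lemma rank_fromCols_replicateCol_of_mem [Finite m] (A : Matrix m n K) {c : m → K}
    (hc : c ∈ LinearMap.range A.mulVecLin) :
    (fromCols A (replicateCol Unit c)).rank = A.rank := by
  rw [rank, rank, range_mulVecLin_fromCols_replicateCol, sup_eq_left.2]
  simpa using hc

lemma rank_fromCols_replicateCol_of_notMem [Finite m] (A : Matrix m n K) {c : m → K}
    (hc : c ∉ LinearMap.range A.mulVecLin) :
    (fromCols A (replicateCol Unit c)).rank = A.rank + 1 := by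
  rw [rank, rank, range_mulVecLin_fromCols_replicateCol,
    Submodule.finrank_sup_span_singleton hc]

lemma sumElim_mem_range_iff (u : Matrix n n K) (b : n → K) (a : K) :
    (Sum.elim b fun _ ↦ a) ∈ LinearMap.range (fromRows u (replicateRow Unit b)).mulVecLin ↔
      ∃ y, u *ᵥ y = b ∧ b ⬝ᵥ y = a := by
  simp only [LinearMap.mem_range, mulVecLin_apply, fromRows_mulVec]
  refine exists_congr fun y ↦ ⟨fun h ↦ ⟨?_, ?_⟩, ?_⟩
  · ext i
    exact congrFun h (Sum.inl i)
  · exact congrFun h (Sum.inr ())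
  · rintro ⟨h₁, h₂⟩
    ext (i | i)
    · exact congrFun h₁ i
    · exact h₂

lemma rank_symmBorder_of_notMem {u : Matrix n n K} (hu : u.IsSymm) {b : n → K}
    (hb : b ∉ LinearMap.range u.mulVecLin) (a : K) : (symmBorder u b a).rank = u.rank + 2 := by
  rw [symmBorder_eq_fromCols, rank_fromCols_replicateCol_of_notMem,
    fromRows_replicateRow_eq_transpose hu, rank_transpose, rank_fromCols_replicateCol_of_notMem u hb]
  rw [sumElim_mem_range_iff]
  rintro ⟨y, hy, -⟩
  exact hb ⟨y, hy⟩

lemma rank_symmBorder_mulVec [DecidableEq K] {u : Matrix n n K} (hu : u.IsSymm) (x : n → K)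
    (a : K) : (symmBorder u (u *ᵥ x) a).rank =
      if a = (u *ᵥ x) ⬝ᵥ x then u.rank else u.rank + 1 := by
  have hx : u *ᵥ x ∈ LinearMap.range u.mulVecLin := ⟨x, rfl⟩
  have hmem : (∃ y, u *ᵥ y = u *ᵥ x ∧ (u *ᵥ x) ⬝ᵥ y = a) ↔ a = (u *ᵥ x) ⬝ᵥ x := by
    constructor
    · rintro ⟨y, hy, rfl⟩
      have h (z : n → K) : (u *ᵥ x) ⬝ᵥ z = x ⬝ᵥ (u *ᵥ z) := by
        rw [dotProduct_mulVec, ← mulVec_transpose, hu.eq]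
      rw [h, h, hy]
    · rintro rfl
      exact ⟨x, rfl, rfl⟩
  have hrow : (fromRows u (replicateRow Unit (u *ᵥ x))).rank = u.rank := by
    rw [fromRows_replicateRow_eq_transpose hu, rank_transpose,
      rank_fromCols_replicateCol_of_mem u hx]
  rw [symmBorder_eq_fromCols]
  split_ifs with h
  · rw [rank_fromCols_replicateCol_of_mem, hrow]
    rwa [sumElim_mem_range_iff, hmem]
  · rw [rank_fromCols_replicateCol_of_notMem, hrow]
    rwa [sumElim_mem_range_iff, hmem]

end Rank

section Count

variable (K : Type*) [Field K] [Fintype K]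

lemma sum_rank_symmBorder {n : Type*} [Fintype n] [DecidableEq n] {u : Matrix n n K} (hu : u.IsSymm)
    (f : ℕ → ℚ) :
    ∑ b : n → K, ∑ a : K, f (symmBorder u b a).rank =
      Fintype.card K ^ u.rank * (f u.rank + (Fintype.card K - 1) * f (u.rank + 1)) +
        (Fintype.card K ^ Fintype.card n - Fintype.card K ^ u.rank) *
          (Fintype.card K * f (u.rank + 2)) := by
  classical
  have hterm (b : n → K) : ∑ a : K, f (symmBorder u b a).rank =
      if b ∈ LinearMap.range u.mulVecLin then
        f u.rank + (Fintype.card K - 1) * f (u.rank + 1)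
      else Fintype.card K * f (u.rank + 2) := by
    split_ifs with hb
    · obtain ⟨x, rfl⟩ := hb
      simp only [mulVecLin_apply, rank_symmBorder_mulVec hu, apply_ite f]
      rw [← Finset.add_sum_erase _ _ (Finset.mem_univ ((u *ᵥ x) ⬝ᵥ x)), if_pos rfl,
        Finset.sum_congr rfl fun a ha ↦ if_neg (Finset.ne_of_mem_erase ha), Finset.sum_const,
        Finset.card_erase_of_mem (Finset.mem_univ _), Finset.card_univ, nsmul_eq_mul,
        Nat.cast_sub Fintype.card_pos, Nat.cast_one]
    · simp [rank_symmBorder_of_notMem hu hb]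
  have hcard : (Finset.univ.filter fun b : n → K ↦ b ∈ LinearMap.range u.mulVecLin).card =
      Fintype.card K ^ u.rank := by
    rw [← Fintype.card_subtype, rank]
    exact Module.card_eq_pow_finrank (K := K) (V := LinearMap.range u.mulVecLin)
  have hcard' : ((Finset.univ.filter fun b : n → K ↦ b ∉ LinearMap.range u.mulVecLin).card : ℚ) =
      Fintype.card K ^ Fintype.card n - Fintype.card K ^ u.rank := by
    have h := Finset.card_filter_add_card_filter_not (s := (Finset.univ : Finset (n → K)))
      (fun b ↦ b ∈ LinearMap.range u.mulVecLin)
    rw [hcard, Finset.card_univ, Fintype.card_fun] at h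
    rw [eq_sub_iff_add_eq']
    exact_mod_cast h
  simp only [hterm]
  rw [Finset.sum_ite, Finset.sum_const, Finset.sum_const, nsmul_eq_mul, nsmul_eq_mul, hcard,
    hcard']
  push_cast
  rfl

open Classical in
/-- The sum of `f (rank u)` over all symmetric `n × n` matrices `u` over `K`. -/
noncomputable def symmRankSum (n : Type*) [Fintype n] (f : ℕ → ℚ) : ℚ :=
  ∑ u : {u : Matrix n n K // u.IsSymm}, f u.1.rank

lemma symmRankSum_congr {m n : Type*} [Fintype m] [Fintype n] (e : m ≃ n) (f : ℕ → ℚ) :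
    symmRankSum K m f = symmRankSum K n f := by
  classical
  refine Fintype.sum_equiv ((reindex e e).subtypeEquiv fun u ↦ ?_) _ _ fun u ↦ ?_
  · refine ⟨fun h ↦ h.submatrix _, fun h ↦ ?_⟩
    simpa using h.submatrix e
  · exact congrArg f (rank_reindex e e u.1).symm

lemma symmRankSum_sum_unit (n : Type*) [Fintype n] (f : ℕ → ℚ) :
    symmRankSum K (n ⊕ Unit) f = symmRankSum K n fun s ↦
      Fintype.card K ^ s * (f s + (Fintype.card K - 1) * f (s + 1)) +
        (Fintype.card K ^ Fintype.card n - Fintype.card K ^ s) * (Fintype.card K * f (s + 2)) := by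
  classical
  have h := Fintype.sum_equiv (symmBorderEquiv K n) (fun t ↦ f (symmBorder t.1.1 t.2.1 t.2.2).rank)
    (fun u ↦ f u.1.rank) fun _ ↦ rfl
  simp only [Fintype.sum_prod_type, fun u : {u : Matrix n n K // u.IsSymm} ↦
    sum_rank_symmBorder K u.2 f] at h
  rw [symmRankSum, symmRankSum, h]
  congr!

lemma symmRankSum_add (n : Type*) [Fintype n] (f g : ℕ → ℚ) :
    symmRankSum K n (fun s ↦ f s + g s) = symmRankSum K n f + symmRankSum K n g :=
  Finset.sum_add_distrib

lemma symmRankSum_mul (n : Type*) [Fintype n] (c : ℚ) (f : ℕ → ℚ) :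
    symmRankSum K n (fun s ↦ c * f s) = c * symmRankSum K n f :=
  (Finset.mul_sum _ _ _).symm

/-- The number of symmetric `n × n` matrices of rank `r` over `K`. -/
noncomputable def symmRankCount (n r : ℕ) : ℚ :=
  symmRankSum K (Fin n) fun s ↦ if s = r then 1 else 0

lemma symmRankCount_eq_card (n r : ℕ) : symmRankCount K n r =
    Nat.card {u : Matrix (Fin n) (Fin n) K // uᵀ = u ∧ u.rank = r} := by
  classical
  have h := Nat.card_congr (Equiv.subtypeSubtypeEquivSubtypeInter
    (fun u : Matrix (Fin n) (Fin n) K ↦ u.IsSymm) fun u ↦ u.rank = r)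
  rw [Nat.card_eq_fintype_card, Fintype.card_subtype] at h
  rw [symmRankCount, symmRankSum, Finset.sum_boole, Nat.cast_inj]
  refine Eq.trans ?_ h
  congr!

lemma symmRankCount_zero_left (r : ℕ) : symmRankCount K 0 r = if r = 0 then 1 else 0 := by
  classical
  have : Unique {u : Matrix (Fin 0) (Fin 0) K // u.IsSymm} :=
    { default := ⟨0, isSymm_zero⟩, uniq := fun u ↦ Subsingleton.elim _ _ }
  rw [symmRankCount, symmRankSum, Fintype.sum_unique]
  have h (u : Matrix (Fin 0) (Fin 0) K) : u.rank = 0 := Nat.le_zero.1 u.rank_le_width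
  rw [h]
  simp only [eq_comm]

lemma symmRankCount_succ (n r : ℕ) : symmRankCount K (n + 1) r =
    symmRankSum K (Fin n) fun s ↦
      Fintype.card K ^ s * ((if s = r then 1 else 0) +
        (Fintype.card K - 1) * (if s + 1 = r then 1 else 0)) +
      (Fintype.card K ^ n - Fintype.card K ^ s) *
        (Fintype.card K * (if s + 2 = r then 1 else 0)) := by
  rw [symmRankCount, symmRankSum_congr K (finSumFinEquiv (m := n) (n := 1)).symm,
    symmRankSum_congr K ((Equiv.refl (Fin n)).sumCongr (Equiv.ofUnique (Fin 1) Unit)),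
    symmRankSum_sum_unit, Fintype.card_fin]

lemma symmRankCount_succ_zero (n : ℕ) : symmRankCount K (n + 1) 0 = symmRankCount K n 0 := by
  rw [symmRankCount_succ, symmRankCount]
  congr 1
  ext s
  by_cases h : s = 0 <;> simp [h]

lemma symmRankCount_succ_one (n : ℕ) : symmRankCount K (n + 1) 1 =
    Fintype.card K * symmRankCount K n 1 + (Fintype.card K - 1) * symmRankCount K n 0 := by
  rw [symmRankCount_succ, symmRankCount, symmRankCount, ← symmRankSum_mul, ← symmRankSum_mul,
    ← symmRankSum_add]
  congr 1
  ext s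
  obtain rfl | rfl | h : s = 0 ∨ s = 1 ∨ 2 ≤ s := by omega
  · simp
  · simp
  · simp [show s ≠ 0 by omega, show s ≠ 1 by omega]

lemma symmRankCount_succ_add_two (n k : ℕ) : symmRankCount K (n + 1) (k + 2) =
    Fintype.card K ^ (k + 2) * symmRankCount K n (k + 2) +
      (Fintype.card K - 1) * Fintype.card K ^ (k + 1) * symmRankCount K n (k + 1) +
      (Fintype.card K ^ (n + 1) - Fintype.card K ^ (k + 1)) * symmRankCount K n k := by
  rw [symmRankCount_succ, symmRankCount, symmRankCount, symmRankCount, ← symmRankSum_mul,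
    ← symmRankSum_mul, ← symmRankSum_mul, ← symmRankSum_add, ← symmRankSum_add]
  congr 1
  ext s
  obtain rfl | rfl | rfl | ⟨h₀, h₁, h₂⟩ :
      s = k ∨ s = k + 1 ∨ s = k + 2 ∨ s ≠ k ∧ s ≠ k + 1 ∧ s ≠ k + 2 := by omega
  · simp
    ring
  · simp
    ring
  · simp
  · simp [h₀, h₁, h₂]

end Count

end Matrix

section Product

/-- The product of `q ^ (n - i) - 1` over `i < r`; it vanishes for `n < r`. -/
def powSubOneProd (q : ℚ) (n r : ℕ) : ℚ :=
  ∏ i ∈ Finset.range r, (q ^ (n - i) - 1)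

lemma powSubOneProd_zero (q : ℚ) (n : ℕ) : powSubOneProd q n 0 = 1 := rfl

lemma powSubOneProd_eq_zero (q : ℚ) {n r : ℕ} (h : n < r) : powSubOneProd q n r = 0 :=
  Finset.prod_eq_zero (Finset.mem_range.2 h) (by simp)

lemma powSubOneProd_succ_succ (q : ℚ) (n r : ℕ) :
    powSubOneProd q (n + 1) (r + 1) = (q ^ (n + 1) - 1) * powSubOneProd q n r := by
  rw [powSubOneProd, Finset.prod_range_succ', mul_comm, powSubOneProd]
  simp

lemma powSubOneProd_succ_mul (q : ℚ) (n r : ℕ) :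
    powSubOneProd q n (r + 1) * q ^ r = powSubOneProd q n r * (q ^ n - q ^ r) := by
  obtain h | h := le_or_gt r n
  · rw [powSubOneProd, Finset.prod_range_succ, mul_assoc, sub_mul, ← pow_add, Nat.sub_add_cancel h,
      one_mul, powSubOneProd]
  · rw [powSubOneProd_eq_zero q h, powSubOneProd_eq_zero q (h.trans (Nat.lt_succ_self r))]
    simp

/-- The product of `q ^ (2 * i) / (q ^ (2 * i) - 1)` over `1 ≤ i ≤ s`. -/
def evenPowRatioProd (q : ℚ) (s : ℕ) : ℚ :=
  ∏ i ∈ Finset.range s, q ^ (2 * (i + 1)) / (q ^ (2 * (i + 1)) - 1)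

lemma evenPowRatioProd_zero (q : ℚ) : evenPowRatioProd q 0 = 1 := rfl

lemma evenPowRatioProd_succ {q : ℚ} (hq : 1 < q) (s : ℕ) :
    evenPowRatioProd q (s + 1) * (q ^ (2 * (s + 1)) - 1) =
      evenPowRatioProd q s * q ^ (2 * (s + 1)) := by
  have h : q ^ (2 * (s + 1)) - 1 ≠ 0 := (sub_pos.2 (one_lt_pow₀ hq (by omega))).ne'
  rw [evenPowRatioProd, Finset.prod_range_succ, mul_assoc, div_mul_cancel₀ _ h, evenPowRatioProd]

lemma evenPowRatioProd_half_add_two {q : ℚ} (hq : 1 < q) (k : ℕ) :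
    evenPowRatioProd q ((k + 2) / 2) * (q ^ (k + 2) - 1) =
      (q - 1) * q ^ (k + 1) * evenPowRatioProd q ((k + 1) / 2) +
        q ^ (k + 1) * evenPowRatioProd q (k / 2) := by
  obtain ⟨j, rfl | rfl⟩ := k.even_or_odd'
  · have h := evenPowRatioProd_succ hq j
    rw [show (2 * j + 2) / 2 = j + 1 by omega, show (2 * j + 1) / 2 = j by omega,
      show 2 * j / 2 = j by omega]
    linear_combination h
  · have h := evenPowRatioProd_succ hq j
    rw [show (2 * j + 1 + 2) / 2 = j + 1 by omega, show (2 * j + 1 + 1) / 2 = j + 1 by omega,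
      show (2 * j + 1) / 2 = j by omega]
    linear_combination h

lemma evenPowRatioProd_mul_prod {q : ℚ} (hq : 1 < q) (s : ℕ) :
    evenPowRatioProd q s * ∏ r ∈ Finset.Icc 1 s, (q ^ (2 * r) - 1) = q ^ (s * (s + 1)) := by
  induction s with
  | zero => simp [evenPowRatioProd_zero]
  | succ s ih =>
    rw [Finset.prod_Icc_succ_top (by omega)]
    linear_combination (∏ r ∈ Finset.Icc 1 s, (q ^ (2 * r) - 1)) * evenPowRatioProd_succ hq s +
      q ^ (2 * (s + 1)) * ih

lemma prod_Icc_pow_sub_one (q : ℚ) {l m : ℕ} (h : m ≤ l) :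
    ∏ r ∈ Finset.Icc (l - m + 1) l, (q ^ r - 1) = powSubOneProd q l m := by
  refine Finset.prod_bij' (fun r _ ↦ l - r) (fun i _ ↦ l - i) ?_ ?_ ?_ ?_ ?_ <;>
    intro a ha <;> simp only [Finset.mem_Icc, Finset.mem_range] at ha ⊢
  iterate 4 omega
  rw [Nat.sub_sub_self ha.2]

end Product

namespace Matrix

lemma symmRankCount_eq (K : Type*) [Field K] [Fintype K] (n r : ℕ) :
    symmRankCount K n r =
      evenPowRatioProd (Fintype.card K) (r / 2) * powSubOneProd (Fintype.card K) n r := by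
  have hq : (1 : ℚ) < Fintype.card K := by exact_mod_cast Fintype.one_lt_card
  induction n generalizing r with
  | zero =>
    rw [symmRankCount_zero_left]
    split_ifs with h
    · subst h
      simp [evenPowRatioProd_zero, powSubOneProd_zero]
    · rw [powSubOneProd_eq_zero _ (Nat.pos_of_ne_zero h), mul_zero]
  | succ n ih =>
    match r with
    | 0 => rw [symmRankCount_succ_zero, ih, powSubOneProd_zero, powSubOneProd_zero]
    | 1 =>
      have h := powSubOneProd_succ_mul (Fintype.card K) n 0
      rw [symmRankCount_succ_one, ih, ih, powSubOneProd_succ_succ]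
      simp only [powSubOneProd_zero, Nat.reduceDiv, evenPowRatioProd_zero] at h ⊢
      linear_combination (Fintype.card K : ℚ) * h
    | k + 2 =>
      have h₁ := powSubOneProd_succ_mul (Fintype.card K) n k
      have h₂ := powSubOneProd_succ_mul (Fintype.card K) n (k + 1)
      have h₃ := evenPowRatioProd_half_add_two hq k
      rw [symmRankCount_succ_add_two, ih, ih, ih, powSubOneProd_succ_succ]
      linear_combination
        (Fintype.card K : ℚ) * evenPowRatioProd (Fintype.card K) ((k + 2) / 2) * h₂ -
        (Fintype.card K : ℚ) * evenPowRatioProd (Fintype.card K) (k / 2) * h₁ -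
        powSubOneProd (Fintype.card K) n (k + 1) * h₃

end Matrix

theorem stmt_6 (p : ℕ) (hp : p.Prime) (hp2 : p ≠ 2) (l m : ℕ) (hml : m ≤ l)
    (hodd : Odd m) :
    Nat.card {u : Matrix (Fin l) (Fin l) (ZMod p) // uᵀ = u ∧ u.rank = m} *
        ∏ r ∈ Finset.Icc 1 ((m - 1) / 2), (p ^ (2 * r) - 1) =
      p ^ ((m ^ 2 - 1) / 4) * ∏ r ∈ Finset.Icc (l - m + 1) l, (p ^ r - 1) := by
  have : Fact p.Prime := ⟨hp⟩
  have hq : (1 : ℚ) < p := by exact_mod_cast hp.one_lt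
  have hcast (r : ℕ) : ((p ^ r - 1 : ℕ) : ℚ) = (p : ℚ) ^ r - 1 := by
    rw [Nat.cast_sub (Nat.one_le_pow _ _ hp.pos), Nat.cast_pow, Nat.cast_one]
  obtain ⟨s, rfl⟩ := hodd
  have hexp : ((2 * s + 1) ^ 2 - 1) / 4 = s * (s + 1) := by
    rw [show (2 * s + 1) ^ 2 = 4 * (s * (s + 1)) + 1 by ring, Nat.add_sub_cancel,
      Nat.mul_div_cancel_left _ (by norm_num)]
  rw [hexp, show (2 * s + 1 - 1) / 2 = s by omega, ← Nat.cast_inj (R := ℚ)]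
  simp only [Nat.cast_mul, Nat.cast_prod, hcast, Nat.cast_pow]
  rw [← Matrix.symmRankCount_eq_card, Matrix.symmRankCount_eq, ZMod.card,
    prod_Icc_pow_sub_one _ hml, show (2 * s + 1) / 2 = s by omega,
    ← evenPowRatioProd_mul_prod hq s]
  ring
end

section
/- Let p be an odd prime and let m ≤ l be natural numbers with m even and m ≥ 2. Let δ ∈ 𝔽_p be a non-square unit and E_m = diag(1, …, 1, δ). Let S₁ = {u : ∃ γ ∈ GL_l(𝔽_p), γᵀ · diag(1_m, 0_{l−m}) · γ = u} be the congruence orbit of diag(1_m, 0_{l−m}) among l×l matrices over 𝔽_p, and S₂ = {u : ∃ γ ∈ GL_l(𝔽_p), γᵀ · diag(E_m, 0_{l−m}) · γ = u} the congruence orbit of diag(E_m, 0_{l−m}). Set ε = ((−1)^{(p−1)/2})^{m/2}. Then, as integers, (#S₁ − #S₂) · ∏_{r=1}^{m/2} (p^{2r} − 1) = ε · p^{m²/4} · ∏_{r=l−m+1}^{l} (p^r − 1). -/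
open Matrix

section Congruence

variable {K : Type*} [Field K] {ι : Type*} [Fintype ι] [DecidableEq ι]

/-- Two square matrices are congruent if `γᵀ * A * γ = B` for some invertible `γ`. -/
def MatrixCongruent (A B : Matrix ι ι K) : Prop :=
  ∃ γ : GL ι K, (γ : Matrix ι ι K)ᵀ * A * (γ : Matrix ι ι K) = B

theorem MatrixCongruent.trans {A B C : Matrix ι ι K} (hAB : MatrixCongruent A B)
    (hBC : MatrixCongruent B C) : MatrixCongruent A C := by
  obtain ⟨γ, rfl⟩ := hAB
  obtain ⟨η, rfl⟩ := hBC
  exact ⟨γ * η, by simp [Matrix.mul_assoc]⟩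

theorem MatrixCongruent.symm {A B : Matrix ι ι K} (h : MatrixCongruent A B) :
    MatrixCongruent B A := by
  obtain ⟨γ, rfl⟩ := h
  refine ⟨γ⁻¹, ?_⟩
  have h1 : (γ : Matrix ι ι K) * ((γ⁻¹ : GL ι K) : Matrix ι ι K) = 1 := by
    rw [← Units.val_mul, mul_inv_cancel, Units.val_one]
  have h2 : ((γ⁻¹ : GL ι K) : Matrix ι ι K)ᵀ * (γ : Matrix ι ι K)ᵀ = 1 := by
    rw [← transpose_mul, h1, transpose_one]
  calc _ = (((γ⁻¹ : GL ι K) : Matrix ι ι K)ᵀ * (γ : Matrix ι ι K)ᵀ) * A *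
        ((γ : Matrix ι ι K) * ((γ⁻¹ : GL ι K) : Matrix ι ι K)) := by
          simp only [Matrix.mul_assoc]
    _ = A := by rw [h1, h2, Matrix.one_mul, Matrix.mul_one]

theorem MatrixCongruent.of_det_ne_zero {A B M : Matrix ι ι K} (h : Mᵀ * A * M = B)
    (hB : B.det ≠ 0) : MatrixCongruent A B := by
  have hM : M.det ≠ 0 := by
    rintro h0
    apply hB
    rw [← h, det_mul, h0, mul_zero]
  exact ⟨GeneralLinearGroup.mkOfDetNeZero M hM, h⟩

theorem MatrixCongruent.exists_diagonal [NeZero (2 : K)] {S : Matrix ι ι K} (hS : S.IsSymm) :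
    ∃ w : ι → K, MatrixCongruent S (diagonal w) := by
  have : Invertible (2 : K) := invertibleOfNonzero two_ne_zero
  have hB : LinearMap.IsSymm (Matrix.toBilin' S) := by
    refine ⟨fun x y => ?_⟩
    simp only [Matrix.toBilin'_apply', RingHom.id_apply]
    rw [← dotProduct_comm, ← Matrix.vecMul_transpose, hS.eq, Matrix.dotProduct_mulVec]
  obtain ⟨v, hv⟩ := LinearMap.BilinForm.exists_orthogonal_basis hB
  let e : Fin (Module.finrank K (ι → K)) ≃ ι :=
    Fintype.equivOfCardEq (by simp)
  let b := v.reindex e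
  refine ⟨fun i => Matrix.toBilin' S (b i) (b i), ?_⟩
  let M : Matrix ι ι K := (Pi.basisFun K ι).toMatrix b
  have hM : M * b.toMatrix (Pi.basisFun K ι) = 1 := Module.Basis.toMatrix_mul_toMatrix_flip _ _
  have hM' : b.toMatrix (Pi.basisFun K ι) * M = 1 := Module.Basis.toMatrix_mul_toMatrix_flip _ _
  refine ⟨⟨M, b.toMatrix (Pi.basisFun K ι), hM, hM'⟩, ?_⟩
  have key : ∀ i j, (Mᵀ * S * M) i j = Matrix.toBilin' S (b i) (b j) := by
    intro i j
    rw [Matrix.toBilin'_apply', Matrix.mul_assoc, Matrix.mul_apply]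
    rfl
  ext i j
  rw [key]
  by_cases hij : i = j
  · subst hij; simp
  · rw [diagonal_apply_ne _ hij]
    have := hv (show e.symm i ≠ e.symm j by simpa using hij)
    simpa [b] using this

/-- The quadratic form `a x² + b y²` represents `1` over a finite field of odd order. -/
theorem exists_mul_sq_add_mul_sq_eq_one [Fintype K] (hK : ringChar K ≠ 2) {a b : K} (ha : a ≠ 0)
    (hb : b ≠ 0) : ∃ x y : K, a * x ^ 2 + b * y ^ 2 = 1 := by
  obtain ⟨x, y, h⟩ := FiniteField.exists_root_sum_quadratic
    (f := Polynomial.C a * Polynomial.X ^ 2 + Polynomial.C 0 * Polynomial.X + Polynomial.C (-1))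
    (g := Polynomial.C b * Polynomial.X ^ 2 + Polynomial.C 0 * Polynomial.X + Polynomial.C 0)
    (Polynomial.degree_quadratic ha) (Polynomial.degree_quadratic hb)
    (FiniteField.odd_card_of_char_ne_two hK)
  refine ⟨x, y, ?_⟩
  simp at h
  linear_combination h

theorem MatrixCongruent.diagonal_update_update [Fintype K] (hK : ringChar K ≠ 2) {w : ι → K}
    (hw : ∀ k, w k ≠ 0) {i j : ι} (hij : i ≠ j) :
    MatrixCongruent (diagonal w)
      (diagonal (Function.update (Function.update w i 1) j (w i * w j))) := by
  obtain ⟨x, y, hxy⟩ := exists_mul_sq_add_mul_sq_eq_one hK (hw i) (hw j)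
  let M : Matrix ι ι K := fun k s =>
    if s = i then (if k = i then x else if k = j then y else 0)
    else if s = j then (if k = i then - w j * y else if k = j then w i * x else 0)
    else if k = s then 1 else 0
  refine MatrixCongruent.of_det_ne_zero (M := M) ?_ ?_
  · ext r s
    have hexp : (Mᵀ * diagonal w * M) r s = ∑ k, M k r * w k * M k s := by
      rw [Matrix.mul_apply]
      simp [Matrix.mul_diagonal]
    rw [hexp]
    by_cases hr : r = i ∨ r = j
    · by_cases hs : s = i ∨ s = j
      · rw [Finset.sum_eq_add i j hij (fun c _ hc => by
          rcases hr with rfl | rfl <;> simp [M, hc.1, hc.2, hij.symm]) (by simp) (by simp)]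
        rcases hr with rfl | rfl <;> rcases hs with rfl | rfl <;>
          simp [M, hij, hij.symm]
        · linear_combination hxy
        · ring
        · ring
        · linear_combination w s * w i * hxy
      · push Not at hs
        rw [Finset.sum_eq_single s (fun c _ hc => by simp [M, hs.1, hs.2, hc]) (by simp)]
        rcases hr with rfl | rfl <;> simp [M, hij.symm, hs.1, hs.2, hs.1.symm, hs.2.symm]
    · push Not at hr
      rw [Finset.sum_eq_single r (fun c _ hc => by simp [M, hr.1, hr.2, hc]) (by simp)]
      by_cases hs : s = i
      · subst hs; simp [M, hr.1, hr.2]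
      by_cases hs' : s = j
      · subst hs'; simp [M, hr.1, hr.2, hij.symm]
      by_cases hrs : r = s
      · subst hrs; simp [M, hr.1, hr.2]
      · simp [M, hr.1, hr.2, hs, hs', hrs]
  · rw [det_diagonal, Finset.prod_ne_zero_iff]
    intro k _
    by_cases h1 : k = j
    · subst h1; simp [hw]
    by_cases h2 : k = i
    · subst h2; simp [h1]
    · simp [h1, h2, hw]

theorem MatrixCongruent.diagonal_prod [Fintype K] (hK : ringChar K ≠ 2) {w : ι → K}
    (hw : ∀ k, w k ≠ 0) (j : ι) :
    MatrixCongruent (diagonal w) (diagonal fun k => if k = j then ∏ i, w i else 1) := by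
  have key : ∀ s : Finset ι, j ∉ s → MatrixCongruent (diagonal w)
      (diagonal fun k => if k ∈ s then 1 else if k = j then (∏ i ∈ s, w i) * w j else w k) := by
    intro s
    induction s using Finset.induction_on with
    | empty =>
      intro _
      refine ⟨1, ?_⟩
      simp only [Units.val_one, transpose_one, Matrix.one_mul, Matrix.mul_one]
      congr 1
      ext k
      by_cases h : k = j <;> simp [h]
    | insert i s his ih =>
      intro hj
      simp only [Finset.mem_insert, not_or] at hj
      refine (ih hj.2).trans ?_
      convert MatrixCongruent.diagonal_update_update hK (i := i) (j := j) ?_ (Ne.symm hj.1) using 2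
      · ext k
        by_cases h1 : k = j
        · subst h1
          simp [hj.1, hj.2, his, Finset.prod_insert, Ne.symm hj.1, mul_assoc]
        · by_cases h2 : k = i
          · subst h2; simp [h1]
          · simp [h1, h2]
      · intro k
        split_ifs
        · exact one_ne_zero
        · exact mul_ne_zero (Finset.prod_ne_zero_iff.mpr fun i _ => hw i) (hw j)
        · exact hw k
  convert key (Finset.univ.erase j) (by simp) using 3 with k
  by_cases h : k = j <;> simp [h, Finset.prod_erase_mul]

theorem MatrixCongruent.det_eq {A B : Matrix ι ι K} (h : MatrixCongruent A B) :
    ∃ c : K, c ≠ 0 ∧ B.det = c ^ 2 * A.det := by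
  obtain ⟨γ, rfl⟩ := h
  refine ⟨(γ : Matrix ι ι K).det, ?_, ?_⟩
  · exact ((Matrix.isUnit_iff_isUnit_det _).mp γ.isUnit).ne_zero
  · rw [det_mul, det_mul, det_transpose]; ring

theorem MatrixCongruent.isSymm {A B : Matrix ι ι K} (h : MatrixCongruent A B) (hA : A.IsSymm) :
    B.IsSymm := by
  obtain ⟨γ, rfl⟩ := h
  simp [Matrix.IsSymm, Matrix.transpose_mul, Matrix.mul_assoc, hA.eq]

theorem matrixCongruent_diagonal_iff [Fintype K] [DecidableEq K] (hK : ringChar K ≠ 2)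
    (j : ι) {d : K} (hd : d ≠ 0) (S : Matrix ι ι K) :
    MatrixCongruent (diagonal fun k => if k = j then d else 1) S ↔
      S.IsSymm ∧ quadraticChar K S.det = quadraticChar K d := by
  have hdet : ∀ a : K, (diagonal fun k => if k = j then a else 1).det = a := by
    intro a; simp [det_diagonal]
  constructor
  · intro h
    refine ⟨h.isSymm (isSymm_diagonal _), ?_⟩
    obtain ⟨c, hc, h⟩ := h.det_eq
    rw [h, hdet, map_mul, map_pow, quadraticChar_sq_one hc, one_mul]
  · rintro ⟨hS, hχ⟩
    have : NeZero (2 : K) := ⟨Ring.two_ne_zero hK⟩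
    have hS0 : S.det ≠ 0 := by
      intro h0
      rw [h0, MulChar.map_zero, eq_comm, quadraticChar_eq_zero_iff] at hχ
      exact hd hχ
    obtain ⟨w, hw⟩ := MatrixCongruent.exists_diagonal hS
    obtain ⟨c, hc, hcw⟩ := hw.det_eq
    rw [det_diagonal] at hcw
    have hw0 : ∀ k, w k ≠ 0 := by
      have : ∏ i, w i ≠ 0 := by rw [hcw]; positivity
      exact fun k => Finset.prod_ne_zero_iff.mp this k (Finset.mem_univ k)
    refine (MatrixCongruent.symm (hw.trans ((MatrixCongruent.diagonal_prod hK hw0 j).trans ?_)))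
    obtain ⟨e, he⟩ : IsSquare (d * (∏ i, w i)) := by
      rw [← quadraticChar_one_iff_isSquare]
      · rw [hcw, map_mul, map_mul, map_pow, quadraticChar_sq_one hc, hχ, one_mul, ← sq,
          quadraticChar_sq_one hd]
      · rw [hcw]; positivity
    have hP : ∏ i, w i ≠ 0 := by rw [hcw]; positivity
    refine MatrixCongruent.of_det_ne_zero
      (M := diagonal fun k => if k = j then e / ∏ i, w i else 1) ?_ (by rwa [hdet])
    rw [diagonal_transpose, diagonal_mul_diagonal, diagonal_mul_diagonal]
    congr 1
    ext k
    by_cases h : k = j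
    · simp only [h, if_true]
      field_simp
      linear_combination -he
    · simp [h]

end Congruence

section OrbitCounting

theorem card_eq_card_range_mul_card_fiber {G X : Type*} [Group G] (f : G → X)
    (hf : ∀ g h, f g = f h ↔ f (g * h⁻¹) = f 1) :
    Nat.card G = Nat.card (Set.range f) * Nat.card {g // f g = f 1} := by
  rw [← Nat.card_prod]
  let c : Set.range f → G := fun x => x.2.choose
  have hc : ∀ x, f (c x) = x := fun x => x.2.choose_spec
  have hmul : ∀ (s : {g // f g = f 1}) x, f (s * c x) = x := fun s x => by
    rw [← hc x, hf]
    simpa [hc x] using s.2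
  refine Nat.card_congr (Equiv.symm (Equiv.ofBijective
    (fun y : Set.range f × {g // f g = f 1} => (y.2 : G) * c y.1) ⟨?_, ?_⟩))
  · rintro ⟨x, s⟩ ⟨y, t⟩ h
    have hxy : x = y := by
      apply Subtype.ext
      rw [← hmul s x, ← hmul t y]
      exact congrArg f h
    subst hxy
    simpa [Subtype.ext_iff] using h
  · intro g
    refine ⟨⟨⟨f g, g, rfl⟩, ⟨g * (c ⟨f g, g, rfl⟩)⁻¹, ?_⟩⟩, by simp⟩
    rw [← hf, hc]

variable {K : Type*} [Field K] {ι κ : Type*} [Fintype ι] [DecidableEq ι] [Fintype κ]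
  [DecidableEq κ]

theorem card_GL_eq_card_congruent_mul_card_isometries (A : Matrix ι ι K) :
    Nat.card (GL ι K) = Nat.card {u // MatrixCongruent A u} *
      Nat.card {γ : GL ι K // (γ : Matrix ι ι K)ᵀ * A * (γ : Matrix ι ι K) = A} := by
  have h := card_eq_card_range_mul_card_fiber
    (fun γ : GL ι K => (γ : Matrix ι ι K)ᵀ * A * (γ : Matrix ι ι K)) (by
      intro g h
      have h1 : (h : Matrix ι ι K) * ((h⁻¹ : GL ι K) : Matrix ι ι K) = 1 := h.mul_inv
      have h2 : ((h⁻¹ : GL ι K) : Matrix ι ι K) * (h : Matrix ι ι K) = 1 := h.inv_mul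
      have h1t := congrArg transpose h1
      have h2t := congrArg transpose h2
      rw [transpose_mul, transpose_one] at h1t h2t
      simp only [Units.val_mul, Units.val_one, transpose_mul, transpose_one, Matrix.one_mul,
        Matrix.mul_one]
      constructor
      · intro e
        calc _ = ((h⁻¹ : GL ι K) : Matrix ι ι K)ᵀ *
              ((g : Matrix ι ι K)ᵀ * A * (g : Matrix ι ι K)) *
              ((h⁻¹ : GL ι K) : Matrix ι ι K) := by simp only [Matrix.mul_assoc]
          _ = (((h⁻¹ : GL ι K) : Matrix ι ι K)ᵀ * (h : Matrix ι ι K)ᵀ) * A *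
              ((h : Matrix ι ι K) * ((h⁻¹ : GL ι K) : Matrix ι ι K)) := by
                rw [e]; simp only [Matrix.mul_assoc]
          _ = A := by rw [h1, h1t, Matrix.one_mul, Matrix.mul_one]
      · intro e
        calc _ = ((h : Matrix ι ι K)ᵀ * ((h⁻¹ : GL ι K) : Matrix ι ι K)ᵀ) *
              ((g : Matrix ι ι K)ᵀ * A * (g : Matrix ι ι K)) *
              (((h⁻¹ : GL ι K) : Matrix ι ι K) * (h : Matrix ι ι K)) := by
                rw [h2, h2t, Matrix.one_mul, Matrix.mul_one]
          _ = (h : Matrix ι ι K)ᵀ * (((h⁻¹ : GL ι K) : Matrix ι ι K)ᵀ * (g : Matrix ι ι K)ᵀ * A *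
              ((g : Matrix ι ι K) * ((h⁻¹ : GL ι K) : Matrix ι ι K))) * (h : Matrix ι ι K) := by
                simp only [Matrix.mul_assoc]
          _ = _ := by rw [e])
  simp only [Units.val_one, transpose_one, Matrix.one_mul, Matrix.mul_one] at h
  exact h

theorem card_isometries_fromBlocks [Finite K] {A : Matrix ι ι K} (hA : A.det ≠ 0) :
    Nat.card {γ : GL (ι ⊕ κ) K // (γ : Matrix (ι ⊕ κ) (ι ⊕ κ) K)ᵀ * fromBlocks A 0 0 0 *
        (γ : Matrix (ι ⊕ κ) (ι ⊕ κ) K) = fromBlocks A 0 0 0} =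
      Nat.card {γ : GL ι K // (γ : Matrix ι ι K)ᵀ * A * (γ : Matrix ι ι K) = A} *
        (Nat.card (GL κ K) * Nat.card (Matrix κ ι K)) := by
  rw [← Nat.card_prod, ← Nat.card_prod]
  refine Nat.card_congr (Equiv.symm (Equiv.ofBijective
    (fun x : {γ : GL ι K // (γ : Matrix ι ι K)ᵀ * A * (γ : Matrix ι ι K) = A} ×
        GL κ K × Matrix κ ι K =>
      ⟨GeneralLinearGroup.mkOfDetNeZero
        (fromBlocks (x.1.1 : Matrix ι ι K) 0 x.2.2 (x.2.1 : Matrix κ κ K)) (by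
          rw [det_fromBlocks_zero₁₂]
          exact mul_ne_zero
            ((Matrix.isUnit_iff_isUnit_det _).mp x.1.1.isUnit).ne_zero
            ((Matrix.isUnit_iff_isUnit_det _).mp x.2.1.isUnit).ne_zero), ?_⟩) ⟨?_, ?_⟩))
  · simp [GeneralLinearGroup.mkOfDetNeZero, fromBlocks_transpose, fromBlocks_multiply, x.1.2]
  · rintro ⟨⟨a, ha⟩, d, c⟩ ⟨⟨a', ha'⟩, d', c'⟩ h
    have h' : fromBlocks (a : Matrix ι ι K) 0 c (d : Matrix κ κ K) =
        fromBlocks (a' : Matrix ι ι K) 0 c' (d' : Matrix κ κ K) :=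
      congrArg (fun z => (z.1 : Matrix (ι ⊕ κ) (ι ⊕ κ) K)) h
    obtain ⟨h1, -, h3, h4⟩ := fromBlocks_inj.mp h'
    simp [Units.ext h1, Units.ext h4, h3]
  · rintro ⟨γ, hγ⟩
    obtain ⟨a, b, c, d, hM⟩ : ∃ a b c d, (γ : Matrix (ι ⊕ κ) (ι ⊕ κ) K) = fromBlocks a b c d :=
      ⟨_, _, _, _, (fromBlocks_toBlocks _).symm⟩
    have hdet := ((Matrix.isUnit_iff_isUnit_det _).mp γ.isUnit).ne_zero
    rw [hM] at hγ hdet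
    simp only [fromBlocks_transpose, fromBlocks_multiply, Matrix.mul_zero, Matrix.zero_mul,
      add_zero, fromBlocks_inj] at hγ
    obtain ⟨haa, hab, -, -⟩ := hγ
    have hb : b = 0 := by
      have hu : IsUnit (aᵀ * A) := by
        rw [Matrix.isUnit_iff_isUnit_det, isUnit_iff_ne_zero]
        intro h0
        apply hA
        rw [← haa, det_mul, h0, zero_mul]
      calc b = (aᵀ * A)⁻¹ * (aᵀ * A * b) := by
            rw [Matrix.nonsing_inv_mul_cancel_left _ _ ((Matrix.isUnit_iff_isUnit_det _).mp hu)]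
        _ = 0 := by rw [hab, Matrix.mul_zero]
    subst hb
    rw [det_fromBlocks_zero₁₂] at hdet
    refine ⟨⟨⟨GeneralLinearGroup.mkOfDetNeZero a (left_ne_zero_of_mul hdet), haa⟩,
      GeneralLinearGroup.mkOfDetNeZero d (right_ne_zero_of_mul hdet), c⟩, ?_⟩
    exact Subtype.ext (Units.ext hM.symm)

theorem card_congruent_fromBlocks [Finite K] {A : Matrix ι ι K} (hA : A.det ≠ 0) :
    Nat.card {u // MatrixCongruent (fromBlocks A 0 0 (0 : Matrix κ κ K)) u} *
        (Nat.card (GL κ K) * Nat.card (Matrix κ ι K) * Nat.card (GL ι K)) =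
      Nat.card (GL (ι ⊕ κ) K) * Nat.card {u // MatrixCongruent A u} := by
  rw [card_GL_eq_card_congruent_mul_card_isometries (fromBlocks A 0 0 (0 : Matrix κ κ K)),
    card_isometries_fromBlocks hA, card_GL_eq_card_congruent_mul_card_isometries A]
  ring

end OrbitCounting

section DetLemmas

variable {K : Type*} [Field K] {ι : Type*} [Fintype ι] [DecidableEq ι]

theorem det_border_border (c : K) (d : ι → K) (U : Matrix ι ι K) :
    (fromBlocks (0 : Matrix Unit Unit K) (replicateRow Unit (Pi.single (Sum.inl ()) 1))
      (replicateCol Unit (Pi.single (Sum.inl ()) 1))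
      (fromBlocks (of fun _ _ => c) (replicateRow Unit d) (replicateCol Unit d) U)).det =
      -U.det := by
  let P : Matrix (Unit ⊕ Unit) (Unit ⊕ Unit) K := fromBlocks 0 1 1 (of fun _ _ => c)
  let P' : Matrix (Unit ⊕ Unit) (Unit ⊕ Unit) K := fromBlocks (of fun _ _ => -c) 1 1 0
  let Q : Matrix (Unit ⊕ Unit) ι K := of (Sum.elim (fun _ => 0) fun _ => d)
  have h1 : P * P' = 1 := by
    ext (i | i) (j | j) <;> simp [P, P', fromBlocks_multiply]
  have h2 : P' * P = 1 := by
    ext (i | i) (j | j) <;> simp [P, P', fromBlocks_multiply]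
  let _ : Invertible P := ⟨P', h2, h1⟩
  have hQ : Qᵀ * P' * Q = 0 := by
    ext i j
    simp [Q, P', Matrix.mul_apply]
  rw [← det_reindex_self (Equiv.sumAssoc Unit Unit ι).symm]
  have hS : Matrix.reindex (Equiv.sumAssoc Unit Unit ι).symm (Equiv.sumAssoc Unit Unit ι).symm
      (fromBlocks (0 : Matrix Unit Unit K) (replicateRow Unit (Pi.single (Sum.inl ()) 1))
      (replicateCol Unit (Pi.single (Sum.inl ()) 1))
      (fromBlocks (of fun _ _ => c) (replicateRow Unit d) (replicateCol Unit d) U)) =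
      fromBlocks P Q Qᵀ U := by
    ext ((i | i) | i) ((j | j) | j) <;> simp [P, Q]
  rw [hS, det_fromBlocks₁₁, show (⅟ P) = P' from rfl, hQ, sub_zero]
  have hP : P.det = -1 := by
    let e : Unit ⊕ Unit ≃ Fin 2 :=
      (Equiv.sumCongr finOneEquiv.symm finOneEquiv.symm).trans finSumFinEquiv
    have h0 : e.symm 0 = Sum.inl () := rfl
    have h1 : e.symm 1 = Sum.inr () := rfl
    rw [← det_reindex_self e, det_fin_two]
    simp [h0, h1, P]
  rw [hP, neg_one_mul]

theorem exists_single_vecMul_eq {b : ι → K} (hb : b ≠ 0) (i : ι) :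
    ∃ M : Matrix ι ι K, M.det ≠ 0 ∧ Pi.single i 1 ᵥ* M = b := by
  obtain ⟨k, hk⟩ := Function.ne_iff.mp hb
  refine ⟨((1 : Matrix ι ι K).updateRow k b).submatrix (Equiv.swap i k) id, ?_, ?_⟩
  · have h : ((1 : Matrix ι ι K).updateRow k b).det = b k := by
      rw [← cramer_transpose_apply, transpose_one, cramer_one]
      rfl
    rw [det_permute, h]
    refine mul_ne_zero ?_ hk
    rcases Int.units_eq_one_or (Equiv.Perm.sign (Equiv.swap i k)) with h | h <;> simp [h]
  · rw [single_one_vecMul]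
    ext j
    simp

end DetLemmas

section SymmetricDetSum

variable (K : Type*) [Field K] [Fintype K] [DecidableEq K]

/-- The sum of the quadratic characters of the determinants of all symmetric matrices. -/
noncomputable def symmDetSum (ι : Type*) [Fintype ι] [DecidableEq ι] : ℤ :=
  ∑ S : {S : Matrix ι ι K // S.IsSymm}, quadraticChar K S.1.det

variable {K} {ι κ : Type*} [Fintype ι] [DecidableEq ι] [Fintype κ] [DecidableEq κ]

theorem symmDetSum_congr (e : ι ≃ κ) : symmDetSum K ι = symmDetSum K κ := by
  refine Fintype.sum_equiv ((Matrix.reindex e e).subtypeEquiv fun S => ?_) _ _ fun S => ?_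
  · constructor
    · exact fun h => h.submatrix _
    · intro h
      simpa using h.submatrix e
  · simp

/-- A symmetric matrix amounts to a corner entry, the rest of its first row, and the
complementary symmetric block. -/
def symmetricBorderEquiv :
    K × (ι → K) × {T : Matrix ι ι K // T.IsSymm} ≃
      {S : Matrix (Unit ⊕ ι) (Unit ⊕ ι) K // S.IsSymm} where
  toFun x := ⟨fromBlocks (of fun _ _ => x.1) (replicateRow Unit x.2.1) (replicateCol Unit x.2.1)
    x.2.2.1, isSymm_fromBlocks_iff.mpr ⟨rfl, rfl, rfl, x.2.2.2⟩⟩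
  invFun S := ⟨S.1 (Sum.inl ()) (Sum.inl ()), fun i => S.1 (Sum.inl ()) (Sum.inr i),
    S.1.toBlocks₂₂, S.2.submatrix _⟩
  left_inv x := rfl
  right_inv S := by
    apply Subtype.ext
    ext (i | i) (j | j)
    · rfl
    · rfl
    · exact S.2.apply _ _
    · rfl

theorem sum_symmetric_border_of_ne_zero {a : K} (ha : a ≠ 0) (b : ι → K) :
    ∑ T : {T : Matrix ι ι K // T.IsSymm},
      quadraticChar K (fromBlocks (of fun _ _ => a) (replicateRow Unit b)
        (replicateCol Unit b) T.1).det = quadraticChar K a * symmDetSum K ι := by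
  let R : Matrix ι ι K :=
    replicateCol Unit b * (of fun _ _ => a⁻¹ : Matrix Unit Unit K) * replicateRow Unit b
  have hR : R.IsSymm := by
    ext i j
    simp [R, Matrix.mul_apply]
    ring
  rw [symmDetSum, Finset.mul_sum]
  refine Fintype.sum_equiv ((Equiv.subRight R).subtypeEquiv fun T => ?_) _ _ fun T => ?_
  · exact ⟨fun h => h.sub hR, fun h => by simpa using h.add hR⟩
  · let _ : Invertible (of fun _ _ => a : Matrix Unit Unit K) :=
      ⟨of fun _ _ => a⁻¹, by ext; simp [Matrix.mul_apply, ha], by ext; simp [Matrix.mul_apply, ha]⟩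
    rw [det_fromBlocks₁₁, map_mul, det_unique]
    rfl

theorem sum_symmetric_congruence {M : Matrix ι ι K} (hM : M.det ≠ 0) (f : Matrix ι ι K → ℤ) :
    ∑ T : {T : Matrix ι ι K // T.IsSymm}, f (Mᵀ * T.1 * M) =
      ∑ T : {T : Matrix ι ι K // T.IsSymm}, f T.1 := by
  have hu : IsUnit M.det := isUnit_iff_ne_zero.mpr hM
  have hu' : IsUnit Mᵀ.det := by rwa [det_transpose]
  let φ : {T : Matrix ι ι K // T.IsSymm} → {T : Matrix ι ι K // T.IsSymm} := fun T =>
    ⟨Mᵀ * T.1 * M, by simp [Matrix.IsSymm, Matrix.transpose_mul, Matrix.mul_assoc, T.2.eq]⟩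
  have hφ : Function.Injective φ := by
    intro S T h
    apply Subtype.ext
    have h1 : Mᵀ * S.1 * M = Mᵀ * T.1 * M := congrArg Subtype.val h
    have h2 := congrArg (fun X => (Mᵀ)⁻¹ * (X * M⁻¹)) h1
    simpa [Matrix.mul_nonsing_inv_cancel_right _ _ hu,
      Matrix.nonsing_inv_mul_cancel_left _ _ hu'] using h2
  exact Fintype.sum_bijective φ (Finite.injective_iff_bijective.mp hφ) _ _ fun _ => rfl

theorem sum_symmetric_border_zero_vecMul {M : Matrix ι ι K} (hM : M.det ≠ 0) (b : ι → K) :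
    ∑ T : {T : Matrix ι ι K // T.IsSymm},
      quadraticChar K (fromBlocks (0 : Matrix Unit Unit K) (replicateRow Unit (b ᵥ* M))
        (replicateCol Unit (b ᵥ* M)) T.1).det =
    ∑ T : {T : Matrix ι ι K // T.IsSymm},
      quadraticChar K (fromBlocks (0 : Matrix Unit Unit K) (replicateRow Unit b)
        (replicateCol Unit b) T.1).det := by
  rw [← sum_symmetric_congruence hM fun T => quadraticChar K (fromBlocks
    (0 : Matrix Unit Unit K) (replicateRow Unit (b ᵥ* M)) (replicateCol Unit (b ᵥ* M)) T).det]
  refine Finset.sum_congr rfl fun T _ => ?_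
  have h : fromBlocks (0 : Matrix Unit Unit K) (replicateRow Unit (b ᵥ* M))
        (replicateCol Unit (b ᵥ* M)) (Mᵀ * T.1 * M) =
      (fromBlocks (1 : Matrix Unit Unit K) 0 0 M)ᵀ * fromBlocks (0 : Matrix Unit Unit K)
        (replicateRow Unit b) (replicateCol Unit b) T.1 *
        fromBlocks (1 : Matrix Unit Unit K) 0 0 M := by
    simp only [fromBlocks_transpose, fromBlocks_multiply, transpose_zero, transpose_one,
      Matrix.mul_zero, Matrix.zero_mul, add_zero, zero_add, Matrix.one_mul, Matrix.mul_one]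
    congr 1
    ext i j
    simp [Matrix.mul_apply, Matrix.vecMul, dotProduct, mul_comm]
  rw [h, det_mul, det_mul, det_transpose, det_fromBlocks_zero₁₂, det_one, one_mul, map_mul,
    map_mul, mul_right_comm, ← sq, ← map_pow, quadraticChar_sq_one' hM, one_mul]

theorem sum_symmetric_border_single :
    ∑ T : {T : Matrix (Unit ⊕ ι) (Unit ⊕ ι) K // T.IsSymm},
      quadraticChar K (fromBlocks (0 : Matrix Unit Unit K)
        (replicateRow Unit (Pi.single (Sum.inl ()) 1))
        (replicateCol Unit (Pi.single (Sum.inl ()) 1)) T.1).det =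
    (Fintype.card K : ℤ) ^ (Fintype.card ι + 1) * (quadraticChar K (-1) * symmDetSum K ι) := by
  rw [← Equiv.sum_comp symmetricBorderEquiv]
  refine (Finset.sum_congr rfl fun x _ => congrArg (quadraticChar K)
    (det_border_border x.1 x.2.1 x.2.2.1)).trans ?_
  simp_rw [← neg_one_mul (Matrix.det _), map_mul, ← Finset.mul_sum, Fintype.sum_prod_type]
  simp only [Finset.sum_const, Finset.card_univ, nsmul_eq_mul, Fintype.card_fun, symmDetSum]
  push_cast
  ring

theorem symmDetSum_unit_sum_unit_sum (hK : ringChar K ≠ 2) :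
    symmDetSum K (Unit ⊕ Unit ⊕ ι) =
      quadraticChar K (-1) * (Fintype.card K : ℤ) ^ (Fintype.card ι + 1) *
        ((Fintype.card K : ℤ) ^ (Fintype.card ι + 1) - 1) * symmDetSum K ι := by
  have hborder : ∀ b : Unit ⊕ ι → K, b ≠ 0 →
      ∑ T : {T : Matrix (Unit ⊕ ι) (Unit ⊕ ι) K // T.IsSymm},
        quadraticChar K (fromBlocks (0 : Matrix Unit Unit K) (replicateRow Unit b)
          (replicateCol Unit b) T.1).det =
      (Fintype.card K : ℤ) ^ (Fintype.card ι + 1) *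
        (quadraticChar K (-1) * symmDetSum K ι) := by
    intro b hb
    obtain ⟨M, hM, rfl⟩ := exists_single_vecMul_eq hb (Sum.inl ())
    rw [sum_symmetric_border_zero_vecMul hM, sum_symmetric_border_single]
  have hzero : ∀ T : Matrix (Unit ⊕ ι) (Unit ⊕ ι) K,
      (fromBlocks (0 : Matrix Unit Unit K) (replicateRow Unit 0) (replicateCol Unit 0) T).det =
        0 := fun T => det_eq_zero_of_row_eq_zero (Sum.inl ()) (by rintro (j | j) <;> simp)
  have hcorner : ∑ b : Unit ⊕ ι → K, ∑ T : {T : Matrix (Unit ⊕ ι) (Unit ⊕ ι) K // T.IsSymm},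
        quadraticChar K (fromBlocks (0 : Matrix Unit Unit K) (replicateRow Unit b)
          (replicateCol Unit b) T.1).det =
      ((Fintype.card K : ℤ) ^ (Fintype.card ι + 1) - 1) *
      ((Fintype.card K : ℤ) ^ (Fintype.card ι + 1) *
        (quadraticChar K (-1) * symmDetSum K ι)) := by
    rw [← Finset.add_sum_erase _ _ (Finset.mem_univ 0),
      Finset.sum_congr rfl fun b hb => hborder b (Finset.ne_of_mem_erase hb)]
    simp_rw [hzero, MulChar.map_zero]
    rw [Finset.sum_const_zero, zero_add, Finset.sum_const, nsmul_eq_mul,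
      Finset.card_erase_of_mem (Finset.mem_univ _), Nat.cast_sub (Finset.card_pos.mpr ⟨0, by simp⟩)]
    simp [add_comm]
  rw [symmDetSum, ← Equiv.sum_comp symmetricBorderEquiv, Fintype.sum_prod_type,
    ← Finset.add_sum_erase _ _ (Finset.mem_univ 0)]
  have hnonzero : ∑ a ∈ Finset.univ.erase (0 : K), quadraticChar K a = 0 := by
    have h := quadraticChar_sum_zero hK
    rwa [← Finset.add_sum_erase _ _ (Finset.mem_univ 0), MulChar.map_zero, zero_add] at h
  have h2 : ∑ a ∈ Finset.univ.erase (0 : K),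
      ∑ y : (Unit ⊕ ι → K) × {T : Matrix (Unit ⊕ ι) (Unit ⊕ ι) K // T.IsSymm},
        quadraticChar K (symmetricBorderEquiv (a, y)).1.det = 0 := by
    have h3 : ∀ a ∈ Finset.univ.erase (0 : K),
        ∑ y : (Unit ⊕ ι → K) × {T : Matrix (Unit ⊕ ι) (Unit ⊕ ι) K // T.IsSymm},
          quadraticChar K (symmetricBorderEquiv (a, y)).1.det =
        quadraticChar K a *
          (Fintype.card (Unit ⊕ ι → K) * symmDetSum K (Unit ⊕ ι)) := by
      intro a ha
      rw [Fintype.sum_prod_type]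
      refine (Finset.sum_congr rfl fun b _ =>
        sum_symmetric_border_of_ne_zero (Finset.ne_of_mem_erase ha) b).trans ?_
      rw [Finset.sum_const, nsmul_eq_mul, Finset.card_univ]
      ring
    rw [Finset.sum_congr rfl h3, ← Finset.sum_mul, hnonzero, zero_mul]
  rw [h2, add_zero, Fintype.sum_prod_type]
  refine hcorner.trans ?_
  ring

theorem symmDetSum_fin_two_mul (hK : ringChar K ≠ 2) (k : ℕ) :
    symmDetSum K (Fin (2 * k)) = quadraticChar K (-1) ^ k * (Fintype.card K : ℤ) ^ (k ^ 2) *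
      ∏ i ∈ Finset.range k, ((Fintype.card K : ℤ) ^ (2 * i + 1) - 1) := by
  induction k with
  | zero =>
    have : ∀ S : {S : Matrix (Fin (2 * 0)) (Fin (2 * 0)) K // S.IsSymm}, S.1.det = 1 :=
      fun S => det_fin_zero
    have hc : Fintype.card {S : Matrix (Fin (2 * 0)) (Fin (2 * 0)) K // S.IsSymm} = 1 :=
      Fintype.card_eq_one_iff.mpr ⟨⟨1, isSymm_one⟩, fun S => Subtype.ext (by ext i; exact i.elim0)⟩
    simp [symmDetSum, this, hc]
  | succ k ih =>
    have e : Fin (2 * (k + 1)) ≃ Unit ⊕ Unit ⊕ Fin (2 * k) :=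
      Fintype.equivOfCardEq (by simp; ring)
    rw [symmDetSum_congr e, symmDetSum_unit_sum_unit_sum hK, ih, Finset.prod_range_succ,
      Fintype.card_fin]
    ring

end SymmetricDetSum

section Counting

theorem card_GL_congr {K : Type*} [Field K] {ι κ : Type*} [Fintype ι] [DecidableEq ι]
    [Fintype κ] [DecidableEq κ] (e : ι ≃ κ) : Nat.card (GL ι K) = Nat.card (GL κ K) :=
  Nat.card_congr (Units.mapEquiv (Matrix.reindexAlgEquiv K K e).toMulEquiv).toEquiv

variable {K : Type*} [Field K] [Fintype K]

theorem card_GL_fin_eq (n : ℕ) :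
    (Nat.card (GL (Fin n) K) : ℤ) = (Fintype.card K : ℤ) ^ (∑ i ∈ Finset.range n, i) *
      ∏ i ∈ Finset.range n, ((Fintype.card K : ℤ) ^ (i + 1) - 1) := by
  have hq : 0 < Fintype.card K := Fintype.card_pos
  rw [Matrix.card_GL_field, Fin.prod_univ_eq_prod_range
    (fun i => Fintype.card K ^ n - Fintype.card K ^ i), ← Finset.prod_range_reflect
    (fun i => (Fintype.card K : ℤ) ^ (i + 1) - 1), ← Finset.prod_pow_eq_pow_sum,
    ← Finset.prod_mul_distrib, Nat.cast_prod]
  refine Finset.prod_congr rfl fun i hi => ?_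
  have hi : i < n := Finset.mem_range.mp hi
  rw [Nat.cast_sub (Nat.pow_le_pow_right hq hi.le), mul_sub, ← pow_add,
    show i + (n - 1 - i + 1) = n by omega]
  simp

theorem card_congruent_sub_card_congruent [DecidableEq K] (hK : ringChar K ≠ 2) {ι : Type*}
    [Fintype ι] [DecidableEq ι] (j : ι) {δ : K} (hδ : ¬ IsSquare δ) :
    (Nat.card {S : Matrix ι ι K // MatrixCongruent 1 S} : ℤ) -
      Nat.card {S : Matrix ι ι K // MatrixCongruent (diagonal fun k => if k = j then δ else 1) S} =
      symmDetSum K ι := by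
  have hδ0 : δ ≠ 0 := by rintro rfl; exact hδ ⟨0, by simp⟩
  have h1 : (1 : Matrix ι ι K) = diagonal fun k => if k = j then 1 else 1 := by simp
  rw [h1]
  simp_rw [matrixCongruent_diagonal_iff hK j one_ne_zero, matrixCongruent_diagonal_iff hK j hδ0,
    map_one, quadraticChar_neg_one_iff_not_isSquare.mpr hδ]
  have h : ∀ a : ℤ, Nat.card {S : Matrix ι ι K // S.IsSymm ∧ quadraticChar K S.det = a} =
      ∑ S : {S : Matrix ι ι K // S.IsSymm}, if quadraticChar K S.1.det = a then (1 : ℤ) else 0 := by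
    intro a
    rw [← Nat.card_congr (Equiv.subtypeSubtypeEquivSubtypeInter
      (fun S : Matrix ι ι K => S.IsSymm) fun S => quadraticChar K S.det = a),
      Nat.card_eq_fintype_card, Fintype.card_subtype, Finset.sum_boole]
  rw [h, h, ← Finset.sum_sub_distrib, symmDetSum]
  refine Finset.sum_congr rfl fun S _ => ?_
  by_cases h0 : S.1.det = 0
  · simp [h0]
  · rcases quadraticChar_dichotomy h0 with h | h <;> simp [h]

theorem card_congruent_fromBlocks_sub [DecidableEq K] (hK : ringChar K ≠ 2) {k r : ℕ}
    (j : Fin (2 * k)) {δ : K} (hδ : ¬ IsSquare δ) :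
    ((Nat.card {u // MatrixCongruent (fromBlocks (1 : Matrix (Fin (2 * k)) (Fin (2 * k)) K) 0 0
        (0 : Matrix (Fin r) (Fin r) K)) u} : ℤ) -
      Nat.card {u // MatrixCongruent (fromBlocks (diagonal fun i => if i = j then δ else 1) 0 0
        (0 : Matrix (Fin r) (Fin r) K)) u}) *
      ∏ i ∈ Finset.range k, ((Fintype.card K : ℤ) ^ (2 * (i + 1)) - 1) =
    quadraticChar K (-1) ^ k * (Fintype.card K : ℤ) ^ (k ^ 2) *
      ∏ i ∈ Finset.range (2 * k), ((Fintype.card K : ℤ) ^ (r + i + 1) - 1) := by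
  have hδ0 : δ ≠ 0 := by rintro rfl; exact hδ ⟨0, by simp⟩
  have h1 := card_congruent_fromBlocks (κ := Fin r)
    (A := (1 : Matrix (Fin (2 * k)) (Fin (2 * k)) K)) (by simp)
  have h2 := card_congruent_fromBlocks (κ := Fin r)
    (A := (diagonal fun i => if i = j then δ else 1 : Matrix (Fin (2 * k)) (Fin (2 * k)) K))
    (by simpa [det_diagonal] using hδ0)
  have h3 := card_congruent_sub_card_congruent hK j hδ
  rw [symmDetSum_fin_two_mul hK] at h3
  rw [card_GL_congr finSumFinEquiv] at h1 h2
  have hq : 1 < (Fintype.card K : ℤ) := by exact_mod_cast Fintype.one_lt_card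
  zify at h1 h2
  simp only [card_GL_fin_eq] at h1 h2
  have hM : (Nat.card (Matrix (Fin r) (Fin (2 * k)) K) : ℤ) =
      (Fintype.card K : ℤ) ^ (2 * k * r) := by
    rw [Nat.card_eq_fintype_card, show Fintype.card (Matrix (Fin r) (Fin (2 * k)) K) =
      Fintype.card (Fin r → Fin (2 * k) → K) from rfl]
    simp [pow_mul]
  rw [hM] at h1 h2
  generalize (Fintype.card K : ℤ) = q at *
  generalize (Nat.card {u // MatrixCongruent (fromBlocks (1 : Matrix (Fin (2 * k)) (Fin (2 * k)) K)
    0 0 (0 : Matrix (Fin r) (Fin r) K)) u} : ℤ) = X₁ at *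
  generalize (Nat.card {u // MatrixCongruent (fromBlocks (diagonal fun i => if i = j then δ else 1)
    0 0 (0 : Matrix (Fin r) (Fin r) K)) u} : ℤ) = X₂ at *
  generalize (Nat.card {S // MatrixCongruent (1 : Matrix (Fin (2 * k)) (Fin (2 * k)) K) S} : ℤ)
    = Y₁ at *
  generalize (Nat.card {S // MatrixCongruent (diagonal fun i : Fin (2 * k) =>
    if i = j then δ else 1) S} : ℤ) = Y₂ at *
  have hsum : ∑ i ∈ Finset.range (2 * k + r), i =
      ∑ i ∈ Finset.range (2 * k), i + ∑ i ∈ Finset.range r, i + 2 * k * r := by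
    rw [Finset.sum_range_add, Finset.sum_add_distrib]
    simp
    ring
  have hprod : ∏ i ∈ Finset.range (2 * k + r), (q ^ (i + 1) - 1) =
      (∏ i ∈ Finset.range r, (q ^ (i + 1) - 1)) *
        ∏ i ∈ Finset.range (2 * k), (q ^ (r + i + 1) - 1) := by
    rw [add_comm, Finset.prod_range_add]
  have hodd : ∏ i ∈ Finset.range (2 * k), (q ^ (i + 1) - 1) =
      (∏ i ∈ Finset.range k, (q ^ (2 * i + 1) - 1)) *
        ∏ i ∈ Finset.range k, (q ^ (2 * (i + 1)) - 1) := by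
    clear * -
    induction k with
    | zero => simp
    | succ k ih =>
      rw [Finset.prod_range_succ, Finset.prod_range_succ, mul_add, mul_one,
        Finset.prod_range_succ, Finset.prod_range_succ, ih]
      ring
  have hne : ∀ (n : ℕ) (f : ℕ → ℕ), ∏ i ∈ Finset.range n, (q ^ (f i + 1) - 1) ≠ 0 := by
    intro n f
    refine Finset.prod_ne_zero_iff.mpr fun i _ => ?_
    have := one_lt_pow₀ hq (Nat.succ_ne_zero (f i))
    exact sub_ne_zero.mpr this.ne'
  have hq0 : ∀ n : ℕ, q ^ n ≠ 0 := fun n => pow_ne_zero n (by omega)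
  have hA := hne r fun i => i
  have hB := hne k fun i => 2 * i
  rw [hsum, hprod, hodd, pow_add, pow_add] at h1 h2
  refine mul_left_cancel₀ (mul_ne_zero (mul_ne_zero (mul_ne_zero
    (hq0 (∑ i ∈ Finset.range (2 * k), i)) (hq0 (∑ i ∈ Finset.range r, i))) (hq0 (2 * k * r)))
    (mul_ne_zero hA hB)) ?_
  linear_combination h1 - h2 + q ^ (∑ i ∈ Finset.range (2 * k), i) *
    q ^ (∑ i ∈ Finset.range r, i) * q ^ (2 * k * r) *
    (∏ i ∈ Finset.range r, (q ^ (i + 1) - 1)) *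
    (∏ i ∈ Finset.range (2 * k), (q ^ (r + i + 1) - 1)) * h3

end Counting

theorem stmt_7 (p : ℕ) (hp : p.Prime) (hp2 : p ≠ 2) (l m : ℕ) (hml : m ≤ l)
    (hm : 2 ≤ m) (heven : Even m)
    (δ : ZMod p) (hδunit : IsUnit δ) (hδ : ¬∃ x : ZMod p, x ^ 2 = δ) :
    ((Nat.card {u : Matrix (Fin m ⊕ Fin (l - m)) (Fin m ⊕ Fin (l - m)) (ZMod p) //
        ∃ γ : GL (Fin m ⊕ Fin (l - m)) (ZMod p),
          (γ : Matrix (Fin m ⊕ Fin (l - m)) (Fin m ⊕ Fin (l - m)) (ZMod p))ᵀ *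
            Matrix.fromBlocks 1 0 0 0 *
            (γ : Matrix (Fin m ⊕ Fin (l - m)) (Fin m ⊕ Fin (l - m)) (ZMod p)) = u} : ℤ) -
      (Nat.card {u : Matrix (Fin m ⊕ Fin (l - m)) (Fin m ⊕ Fin (l - m)) (ZMod p) //
        ∃ γ : GL (Fin m ⊕ Fin (l - m)) (ZMod p),
          (γ : Matrix (Fin m ⊕ Fin (l - m)) (Fin m ⊕ Fin (l - m)) (ZMod p))ᵀ *
            Matrix.fromBlocks
              (Matrix.diagonal (fun i : Fin m => if (i : ℕ) = m - 1 then δ else 1)) 0 0 0 *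
            (γ : Matrix (Fin m ⊕ Fin (l - m)) (Fin m ⊕ Fin (l - m)) (ZMod p)) = u} : ℤ)) *
        ∏ r ∈ Finset.Icc 1 (m / 2), ((p : ℤ) ^ (2 * r) - 1) =
      ((-1 : ℤ) ^ ((p - 1) / 2)) ^ (m / 2) * (p : ℤ) ^ (m ^ 2 / 4) *
        ∏ r ∈ Finset.Icc (l - m + 1) l, ((p : ℤ) ^ r - 1) := by
  have : Fact p.Prime := ⟨hp⟩
  have hK : ringChar (ZMod p) ≠ 2 := by rwa [ZMod.ringChar_zmod_n]
  have hδ' : ¬ IsSquare δ := fun ⟨x, hx⟩ => hδ ⟨x, by rw [hx, sq]⟩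
  obtain ⟨k, rfl⟩ := heven
  rw [← two_mul] at *
  generalize hr : l - 2 * k = r
  obtain rfl : l = 2 * k + r := by omega
  have h := card_congruent_fromBlocks_sub (r := r) hK
    (⟨2 * k - 1, by omega⟩ : Fin (2 * k)) hδ'
  have hχ : quadraticChar (ZMod p) (-1) = (-1) ^ ((p - 1) / 2) := by
    have hp1 := hp.eq_one_or_self_of_dvd 2
    rw [quadraticChar_neg_one hK, ZMod.card, ZMod.χ₄_eq_neg_one_pow (by omega)]
    congr 1
    omega
  have h4 : (2 * k) ^ 2 / 4 = k ^ 2 := by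
    rw [mul_pow]
    exact Nat.mul_div_cancel_left _ (by norm_num)
  rw [hχ, ZMod.card] at h
  simp only [Fin.ext_iff] at h
  rw [Nat.mul_div_cancel_left k two_pos, h4]
  have hIcc : ∀ (f : ℕ → ℤ) (a n : ℕ), ∏ i ∈ Finset.Icc (a + 1) (n + a), f i =
      ∏ i ∈ Finset.range n, f (a + i + 1) := by
    intro f a n
    rw [← Finset.Ico_add_one_right_eq_Icc, Finset.prod_Ico_eq_prod_range,
      show n + a + 1 - (a + 1) = n by omega]
    exact Finset.prod_congr rfl fun i _ => by rw [add_right_comm]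
  rw [hIcc, show ∏ r ∈ Finset.Icc 1 k, ((p : ℤ) ^ (2 * r) - 1) =
    ∏ i ∈ Finset.range k, ((p : ℤ) ^ (2 * (i + 1)) - 1) by
      simpa using hIcc (fun r => (p : ℤ) ^ (2 * r) - 1) 0 k]
  exact h
end
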